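/- Main regret bound (combined form): Suppose μ*, μ̂ are policies on finite X, A, with induced Markov transition matrices P*, P̂ (P_μ(y|x) = Σ_a μ(a|x)P(y|x,a)) having unique stationary distributions π*, π̂, and suppose D_{π*}(μ*‖μ̂) := Σ_x π*(x) D(μ*(·|x)‖μ̂(·|x)) ≤ ε. Let κ = ‖Ẑ‖₁ be the ℓ₁-induced norm of the fundamental matrix Ẑ = (I − P̂ + e·π̂')⁻¹. Then |R̄(μ*) − R̄(μ̂)| ≤ √(2 ε log 2) · R_max · (1 + κ), where R̄(μ) = Σ_x π_μ(x) Σ_a μ(a|x) R(x,a) and R_max = max_{(x,a)} |R(x,a)|. -/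

import Mathlib

open Real Finset Matrix

/-- Value of a univariate integer polynomial, given by its list of coefficients. -/
noncomputable def polyEval : List ℤ → ℝ → ℝ
  | [], _ => 0
  | c :: cs, x => c + x * polyEval cs x

/-- Value of a bivariate integer polynomial, given by its coefficients in the first variable. -/
noncomputable def polyEval₂ : List (List ℤ) → ℝ → ℝ → ℝ
  | [], _, _ => 0
  | p :: ps, s, t => polyEval p t + s * polyEval₂ ps s t

def polyAdd : List ℤ → List ℤ → List ℤ
  | [], q => q
  | p, [] => p
  | c :: cs, d :: ds => (c + d) :: polyAdd cs ds

def polyAdd₂ : List (List ℤ) → List (List ℤ) → List (List ℤ)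
  | [], q => q
  | p, [] => p
  | c :: cs, d :: ds => polyAdd c d :: polyAdd₂ cs ds

def polyShift (e : ℤ) : List ℤ → List ℤ
  | [] => []
  | c :: cs => polyAdd (c :: polyShift e cs) ((polyShift e cs).map (e * ·))

def polyShift₂ (e : ℤ) : List (List ℤ) → List (List ℤ)
  | [] => []
  | c :: cs => polyAdd₂ (c :: polyShift₂ e cs) ((polyShift₂ e cs).map (·.map (e * ·)))

/-- `polyHom r D p` is the polynomial `r ^ D * p (x / r)`. -/
def polyHom (r : ℤ) : ℕ → List ℤ → List ℤ
  | _, [] => []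
  | 0, c :: _ => [c]
  | D + 1, c :: cs => (r ^ (D + 1) * c) :: polyHom r D cs

def polyHom₂ (r : ℤ) (E : ℕ) : ℕ → List (List ℤ) → List (List ℤ)
  | _, [] => []
  | 0, c :: _ => [polyHom r E c]
  | D + 1, c :: cs => (polyHom r E c).map (r ^ (D + 1) * ·) :: polyHom₂ r E D cs

/-- An upper bound of `|p|` on `[-b, b]`. -/
def polyBound (b : ℤ) : List ℤ → ℤ
  | [] => 0
  | c :: cs => |c| + b * polyBound b cs

def polyBound₂ (a b : ℤ) : List (List ℤ) → ℤ
  | [] => 0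
  | p :: ps => polyBound b p + a * polyBound₂ a b ps

/-- Certifies `p > 0` on `[-a, a] × [-b, b]` by comparing the constant term with the others. -/
def polyPos (a b : ℤ) : List (List ℤ) → Bool
  | (c :: cs) :: ps => decide (b * polyBound b cs + a * polyBound₂ a b ps < c)
  | _ => false

/-- Certifies, by bisection, that at each point of `[-a, a] × [-b, b]` one of the polynomials
is positive. -/
def polyCover : ℕ → Bool → ℤ → ℤ → List (List (List ℤ)) → Bool
  | 0, _, a, b, ps => ps.any (polyPos a b)
  | n + 1, true, a, b, ps => ps.any (polyPos a b) || (decide (2 * (a / 2) = a) &&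
      polyCover n false (a / 2) b (ps.map (polyShift₂ (a / 2))) &&
       polyCover n false (a / 2) b (ps.map (polyShift₂ (-(a / 2)))))
  | n + 1, false, a, b, ps => ps.any (polyPos a b) || (decide (2 * (b / 2) = b) &&
      polyCover n true a (b / 2) (ps.map (·.map (polyShift (b / 2)))) &&
       polyCover n true a (b / 2) (ps.map (·.map (polyShift (-(b / 2))))))

def polyCheck (ps : List (List (List ℤ))) : Bool :=
  ps.all (fun p => decide (p.length ≤ 10) && p.all (fun q => decide (q.length ≤ 10))) &&
    polyCover 20 true 1024 1024 (ps.map (polyHom₂ 1024 9 9))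

theorem polyEval_add (p q : List ℤ) (x : ℝ) :
    polyEval (polyAdd p q) x = polyEval p x + polyEval q x := by
  induction p generalizing q with
  | nil => simp [polyAdd, polyEval]
  | cons c cs ih =>
    cases q with
    | nil => simp [polyAdd, polyEval]
    | cons d ds => simp only [polyAdd, polyEval, ih]; push_cast; ring

theorem polyEval₂_add (p q : List (List ℤ)) (s t : ℝ) :
    polyEval₂ (polyAdd₂ p q) s t = polyEval₂ p s t + polyEval₂ q s t := by
  induction p generalizing q with
  | nil => simp [polyAdd₂, polyEval₂]
  | cons c cs ih =>
    cases q with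
    | nil => simp [polyAdd₂, polyEval₂]
    | cons d ds => simp only [polyAdd₂, polyEval₂, ih, polyEval_add]; ring

theorem polyEval_map_mul (e : ℤ) (p : List ℤ) (x : ℝ) :
    polyEval (p.map (e * ·)) x = e * polyEval p x := by
  induction p with
  | nil => simp [polyEval]
  | cons c cs ih => simp only [List.map_cons, polyEval, ih]; push_cast; ring

theorem polyEval₂_map_mul (e : ℤ) (p : List (List ℤ)) (s t : ℝ) :
    polyEval₂ (p.map (·.map (e * ·))) s t = e * polyEval₂ p s t := by
  induction p with
  | nil => simp [polyEval₂]
  | cons c cs ih => simp only [List.map_cons, polyEval₂, ih, polyEval_map_mul]; ring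

theorem polyEval_shift (e : ℤ) (p : List ℤ) (x : ℝ) :
    polyEval (polyShift e p) x = polyEval p (x + e) := by
  induction p with
  | nil => simp [polyShift, polyEval]
  | cons c cs ih => simp only [polyShift, polyEval_add, polyEval_map_mul, polyEval, ih]; ring

theorem polyEval₂_shift (e : ℤ) (p : List (List ℤ)) (s t : ℝ) :
    polyEval₂ (polyShift₂ e p) s t = polyEval₂ p (s + e) t := by
  induction p with
  | nil => simp [polyShift₂, polyEval₂]
  | cons c cs ih => simp only [polyShift₂, polyEval₂_add, polyEval₂_map_mul, polyEval₂, ih]; ring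

theorem polyEval₂_map_shift (e : ℤ) (p : List (List ℤ)) (s t : ℝ) :
    polyEval₂ (p.map (polyShift e)) s t = polyEval₂ p s (t + e) := by
  induction p with
  | nil => simp [polyEval₂]
  | cons c cs ih => simp only [List.map_cons, polyEval₂, ih, polyEval_shift]

theorem polyEval_hom (r : ℤ) (D : ℕ) (p : List ℤ) (hp : p.length ≤ D + 1) (x : ℝ) :
    polyEval (polyHom r D p) (r * x) = r ^ D * polyEval p x := by
  induction p generalizing D with
  | nil => cases D <;> simp [polyHom, polyEval]
  | cons c cs ih =>
    cases D with
    | zero =>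
      have : cs = [] := by simpa using hp
      simp [polyHom, polyEval, this]
    | succ D =>
      simp only [polyHom, polyEval, ih D (by simpa using hp)]; push_cast; ring

theorem polyEval₂_hom (r : ℤ) (E D : ℕ) (p : List (List ℤ)) (hp : p.length ≤ D + 1)
    (hq : ∀ q ∈ p, q.length ≤ E + 1) (s t : ℝ) :
    polyEval₂ (polyHom₂ r E D p) (r * s) (r * t) = r ^ D * r ^ E * polyEval₂ p s t := by
  induction p generalizing D with
  | nil => cases D <;> simp [polyHom₂, polyEval₂]
  | cons c cs ih =>
    have hc := polyEval_hom r E c (hq c (by simp)) t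
    cases D with
    | zero =>
      have : cs = [] := by simpa using hp
      simp [polyHom₂, polyEval₂, this, hc]
    | succ D =>
      simp only [polyHom₂, polyEval₂, polyEval_map_mul,
        ih D (by simpa using hp) (fun q h => hq q (by simp [h])), hc]
      push_cast; ring

theorem abs_polyEval_le {b : ℤ} {x : ℝ} (hx : |x| ≤ b) (p : List ℤ) :
    |polyEval p x| ≤ polyBound b p := by
  induction p with
  | nil => simp [polyEval, polyBound]
  | cons c cs ih =>
    simp only [polyEval, polyBound]
    push_cast
    calc |(c : ℝ) + x * polyEval cs x| ≤ |(c : ℝ)| + |x| * |polyEval cs x| := by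
          rw [← abs_mul]; exact abs_add_le _ _
      _ ≤ _ := by
          have := mul_le_mul hx ih (abs_nonneg _) ((abs_nonneg x).trans hx)
          linarith

theorem abs_polyEval₂_le {a b : ℤ} {s t : ℝ} (hs : |s| ≤ a) (ht : |t| ≤ b)
    (p : List (List ℤ)) : |polyEval₂ p s t| ≤ polyBound₂ a b p := by
  induction p with
  | nil => simp [polyEval₂, polyBound₂]
  | cons c cs ih =>
    simp only [polyEval₂, polyBound₂]
    push_cast
    calc |polyEval c t + s * polyEval₂ cs s t| ≤ |polyEval c t| + |s| * |polyEval₂ cs s t| := by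
          rw [← abs_mul]; exact abs_add_le _ _
      _ ≤ _ := by
          have := mul_le_mul hs ih (abs_nonneg _) ((abs_nonneg s).trans hs)
          have := abs_polyEval_le ht c
          linarith

theorem polyEval₂_pos_of_polyPos {a b : ℤ} {s t : ℝ} (hs : |s| ≤ a) (ht : |t| ≤ b)
    {p : List (List ℤ)} (hp : polyPos a b p = true) : 0 < polyEval₂ p s t := by
  match p, hp with
  | (c :: cs) :: ps, hp =>
    have h : b * polyBound b cs + a * polyBound₂ a b ps < c := by simpa [polyPos] using hp
    have h' : (b * polyBound b cs + a * polyBound₂ a b ps : ℝ) < c := by exact_mod_cast h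
    simp only [polyEval₂, polyEval]
    have h1 : |t * polyEval cs t| ≤ b * polyBound b cs := by
      rw [abs_mul]
      exact mul_le_mul ht (abs_polyEval_le ht cs) (abs_nonneg _) ((abs_nonneg t).trans ht)
    have h2 : |s * polyEval₂ ps s t| ≤ a * polyBound₂ a b ps := by
      rw [abs_mul]
      exact mul_le_mul hs (abs_polyEval₂_le hs ht ps) (abs_nonneg _) ((abs_nonneg s).trans hs)
    linarith [abs_le.1 h1, abs_le.1 h2]

theorem exists_shift_abs_le {a e : ℤ} (he : 2 * e = a) {s : ℝ} (hs : |s| ≤ a) :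
    |s - e| ≤ e ∨ |s + e| ≤ e := by
  have h : (2 * e : ℝ) = a := by exact_mod_cast he
  rw [abs_le] at hs
  rcases le_total 0 s with h0 | h0
  · left; rw [abs_le]; constructor <;> linarith
  · right; rw [abs_le]; constructor <;> linarith

theorem exists_pos_of_any_polyPos {a b : ℤ} {s t : ℝ} (hs : |s| ≤ a) (ht : |t| ≤ b)
    {ps : List (List (List ℤ))} (h : ps.any (polyPos a b) = true) :
    ∃ p ∈ ps, 0 < polyEval₂ p s t := by
  obtain ⟨p, hp, h⟩ := List.any_eq_true.1 h
  exact ⟨p, hp, polyEval₂_pos_of_polyPos hs ht h⟩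

theorem exists_pos_of_polyCover (n : ℕ) (f : Bool) (a b : ℤ) (ps : List (List (List ℤ)))
    (h : polyCover n f a b ps = true) {s t : ℝ} (hs : |s| ≤ a) (ht : |t| ≤ b) :
    ∃ p ∈ ps, 0 < polyEval₂ p s t := by
  induction n generalizing f a b ps s t with
  | zero => exact exists_pos_of_any_polyPos hs ht (by simpa [polyCover] using h)
  | succ n ih =>
    cases f <;> simp only [polyCover, Bool.or_eq_true, Bool.and_eq_true, decide_eq_true_eq] at h
    · rcases h with h | ⟨⟨he, h1⟩, h2⟩
      · exact exists_pos_of_any_polyPos hs ht h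
      · rcases exists_shift_abs_le he ht with h' | h'
        · obtain ⟨p, hp, h⟩ := ih _ _ _ _ h1 hs h'
          obtain ⟨q, hq, rfl⟩ := List.mem_map.1 hp
          refine ⟨q, hq, ?_⟩
          simpa only [polyEval₂_map_shift, sub_add_cancel] using h
        · rw [← sub_neg_eq_add, ← Int.cast_neg] at h'
          obtain ⟨p, hp, h⟩ := ih _ _ _ _ h2 hs h'
          obtain ⟨q, hq, rfl⟩ := List.mem_map.1 hp
          refine ⟨q, hq, ?_⟩
          simpa only [polyEval₂_map_shift, sub_add_cancel] using h
    · rcases h with h | ⟨⟨he, h1⟩, h2⟩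
      · exact exists_pos_of_any_polyPos hs ht h
      · rcases exists_shift_abs_le he hs with h' | h'
        · obtain ⟨p, hp, h⟩ := ih _ _ _ _ h1 h' ht
          obtain ⟨q, hq, rfl⟩ := List.mem_map.1 hp
          refine ⟨q, hq, ?_⟩
          simpa only [polyEval₂_shift, sub_add_cancel] using h
        · rw [← sub_neg_eq_add, ← Int.cast_neg] at h'
          obtain ⟨p, hp, h⟩ := ih _ _ _ _ h2 h' ht
          obtain ⟨q, hq, rfl⟩ := List.mem_map.1 hp
          refine ⟨q, hq, ?_⟩
          simpa only [polyEval₂_shift, sub_add_cancel] using h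

theorem exists_pos_of_polyCheck {ps : List (List (List ℤ))} (h : polyCheck ps = true)
    {s t : ℝ} (hs : |s| ≤ 1) (ht : |t| ≤ 1) : ∃ p ∈ ps, 0 < polyEval₂ p s t := by
  simp only [polyCheck, Bool.and_eq_true, List.all_eq_true, decide_eq_true_eq] at h
  obtain ⟨hl, hc⟩ := h
  obtain ⟨p, hp, h⟩ := exists_pos_of_polyCover _ _ _ _ _ hc
    (s := ((1024 : ℤ) : ℝ) * s) (t := ((1024 : ℤ) : ℝ) * t)
    (by rw [abs_mul]; norm_num; linarith) (by rw [abs_mul]; norm_num; linarith)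
  obtain ⟨q, hq, rfl⟩ := List.mem_map.1 hp
  rw [polyEval₂_hom _ _ _ _ (hl q hq).1 (hl q hq).2] at h
  exact ⟨q, hq, pos_of_mul_pos_right h (by positivity)⟩

noncomputable def gapPoly (m q l a : ℝ) : ℝ :=
  m * (1 + l ^ 2 / 6) -
    q * (1 + l ^ 2 / 3 + 0.0525 * l ^ 4) * (1 - l * a + 0.57 * (l * a) ^ 2) -
    (1 - a ^ 2) / 2 - l * (a - a ^ 3) / 6 - l ^ 2 / 24 - (1 + a) * l ^ 3 / 112

/-- With `w = 1 + a`, `v = l * a`, `x = l * w`, this is the quotient by `l` of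
`l * m * s - l * w * K * (s + l ^ 4 / 100) * (1 - x / 2 + x ^ 2 / 6) +
  w * ((1 + v + v ^ 2 / 2 + v ^ 3 / 6) * (1 - x ^ 2 / 3 + 0.14 * x ^ 3) - s - l ^ 4 / 100)`
where `s = 1 + l ^ 2 / 6`. -/
noncomputable def edgePoly (m K l a : ℝ) : ℝ :=
  m * (1 + l ^ 2 / 6) -
    (1 + a) * K * (1 + l ^ 2 / 6 + l ^ 4 / 100) *
      (1 - l * (1 + a) / 2 + (l * (1 + a)) ^ 2 / 6) +
    (1 + a) * (a * (1 + l * a / 2 + (l * a) ^ 2 / 6) *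
      (1 - (l * (1 + a)) ^ 2 / 3 + 0.14 * (l * (1 + a)) ^ 3) -
      l * (1 + a) ^ 2 / 3 + 0.14 * l ^ 2 * (1 + a) ^ 3 - l / 6 - l ^ 3 / 100)

noncomputable def vertexPoly (K l a : ℝ) : ℝ :=
  K * (1 + l ^ 2 / 6) - (1 + a) * (1 + l * a + 0.57 * (l * a) ^ 2) *
    (1 - l * (1 + a) / 2 + (l * (1 + a)) ^ 2 / 6)

theorem gapPoly_nonneg_a_50_65_50 {l a : ℝ} (hl : 0 ≤ l)
    (h1 : (-1) + 0.6931 * l ≤ a)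
    (h2 : a ≤ 1 - 0.6931 * l) :
    0 ≤ gapPoly 0.6921 0.1251 l a := by
  obtain ⟨p, hp, h⟩ := exists_pos_of_polyCheck (ps := [[[8793750, 0, 65625000], [0, -10911250, 0, 43750000], [16791250, 0, -37436175], [-9375000, 34410000], [-13792275, 0, -49914900], [0, 27584550], [0, 0, -31446387]],
    [[], [-2]],
    [[-5000, -5000], [6931]],
    [[-5000, 5000], [6931]]])
    (by decide +kernel) (s := l / 2) (t := a)
    (abs_le.2 ⟨by linarith, by linarith⟩) (abs_le.2 ⟨by linarith, by linarith⟩)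
  simp only [List.mem_cons, List.not_mem_nil, or_false] at hp
  rcases hp with rfl | rfl | rfl | rfl <;> simp only [polyEval₂, polyEval] at h <;> push_cast at h
  · unfold gapPoly; linarith
  all_goals linarith

theorem gapPoly_nonneg_a_50_65_65 {l a : ℝ} (hl : 0 ≤ l)
    (h1 : (-1) + 0.6931 * l ≤ a)
    (h2 : a ≤ 1 - 0.6931 * l) :
    0 ≤ gapPoly 0.8 0.2113 l a := by
  obtain ⟨p, hp, h⟩ := exists_pos_of_polyCheck (ps := [[[11641875, 0, 65625000], [0, 11716250, 0, 43750000], [11147500, 0, -63231525], [-9375000, 64580000], [-23295825, 0, -84308700], [0, 46591650], [0, 0, -53114481]],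
    [[], [-2]],
    [[-5000, -5000], [6931]],
    [[-5000, 5000], [6931]]])
    (by decide +kernel) (s := l / 2) (t := a)
    (abs_le.2 ⟨by linarith, by linarith⟩) (abs_le.2 ⟨by linarith, by linarith⟩)
  simp only [List.mem_cons, List.not_mem_nil, or_false] at hp
  rcases hp with rfl | rfl | rfl | rfl <;> simp only [polyEval₂, polyEval] at h <;> push_cast at h
  · unfold gapPoly; linarith
  all_goals linarith

theorem gapPoly_nonneg_a_65_80_65 {l a : ℝ} (hl : 0 ≤ l)
    (h1 : (-1) + 0.801 * l ≤ a)
    (h2 : a ≤ 1 - 0.801 * l) :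
    0 ≤ gapPoly 0.8 0.2113 l a := by
  obtain ⟨p, hp, h⟩ := exists_pos_of_polyCheck (ps := [[[11641875, 0, 65625000], [0, 11716250, 0, 43750000], [11147500, 0, -63231525], [-9375000, 64580000], [-23295825, 0, -84308700], [0, 46591650], [0, 0, -53114481]],
    [[], [-2]],
    [[-500, -500], [801]],
    [[-500, 500], [801]]])
    (by decide +kernel) (s := l / 2) (t := a)
    (abs_le.2 ⟨by linarith, by linarith⟩) (abs_le.2 ⟨by linarith, by linarith⟩)
  simp only [List.mem_cons, List.not_mem_nil, or_false] at hp
  rcases hp with rfl | rfl | rfl | rfl <;> simp only [polyEval₂, polyEval] at h <;> push_cast at h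
  · unfold gapPoly; linarith
  all_goals linarith

theorem gapPoly_nonneg_a_65_80_80 {l a : ℝ} (hl : 0 ≤ l)
    (h1 : (-1) + 0.801 * l ≤ a)
    (h2 : a ≤ 1 - 0.801 * l) :
    0 ≤ gapPoly 0.9157 0.3201 l a := by
  obtain ⟨p, hp, h⟩ := exists_pos_of_polyCheck (ps := [[[12547500, 0, 65625000], [0, 40276250, 0, 43750000], [2231250, 0, -95789925], [-9375000, 102660000], [-35291025, 0, -127719900], [0, 70582050], [0, 0, -80463537]],
    [[], [-2]],
    [[-500, -500], [801]],
    [[-500, 500], [801]]])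
    (by decide +kernel) (s := l / 2) (t := a)
    (abs_le.2 ⟨by linarith, by linarith⟩) (abs_le.2 ⟨by linarith, by linarith⟩)
  simp only [List.mem_cons, List.not_mem_nil, or_false] at hp
  rcases hp with rfl | rfl | rfl | rfl <;> simp only [polyEval₂, polyEval] at h <;> push_cast at h
  · unfold gapPoly; linarith
  all_goals linarith

theorem gapPoly_nonneg_a_80_97_80 {l a : ℝ} (hl : 0 ≤ l)
    (h1 : (-0.65) + 0.9166 * l ≤ a)
    (h2 : a ≤ 1 - 0.9166 * l) :
    0 ≤ gapPoly 0.9154 0.3201 l a := by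
  obtain ⟨p, hp, h⟩ := exists_pos_of_polyCheck (ps := [[[12508125, 0, 65625000], [0, 40276250, 0, 43750000], [2205000, 0, -95789925], [-9375000, 102660000], [-35291025, 0, -127719900], [0, 70582050], [0, 0, -80463537]],
    [[], [-2]],
    [[-1625, -2500], [4583]],
    [[-2500, 2500], [4583]]])
    (by decide +kernel) (s := l / 2) (t := a)
    (abs_le.2 ⟨by linarith, by linarith⟩) (abs_le.2 ⟨by linarith, by linarith⟩)
  simp only [List.mem_cons, List.not_mem_nil, or_false] at hp
  rcases hp with rfl | rfl | rfl | rfl <;> simp only [polyEval₂, polyEval] at h <;> push_cast at h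
  · unfold gapPoly; linarith
  all_goals linarith

theorem gapPoly_nonneg_a_80_97_97 {l a : ℝ} (hl : 0 ≤ l)
    (h1 : (-0.65) + 0.9166 * l ≤ a)
    (h2 : a ≤ 1 - 0.9166 * l) :
    0 ≤ gapPoly 1.0559 0.4705 l a := by
  obtain ⟨p, hp, h⟩ := exists_pos_of_polyCheck (ps := [[[2241750, 0, 13125000], [0, 15951250, 0, 8750000], [-2364250, 0, -28159425], [-1875000, 31060000], [-10374525, 0, -37545900], [0, 20749050], [0, 0, -23653917]],
    [[], [-2]],
    [[-1625, -2500], [4583]],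
    [[-2500, 2500], [4583]]])
    (by decide +kernel) (s := l / 2) (t := a)
    (abs_le.2 ⟨by linarith, by linarith⟩) (abs_le.2 ⟨by linarith, by linarith⟩)
  simp only [List.mem_cons, List.not_mem_nil, or_false] at hp
  rcases hp with rfl | rfl | rfl | rfl <;> simp only [polyEval₂, polyEval] at h <;> push_cast at h
  · unfold gapPoly; linarith
  all_goals linarith

theorem gapPoly_nonneg_a_97_113_97 {l a : ℝ} (hl : 0 ≤ l)
    (h1 : (-0.65) + 1.0572 * l ≤ a)
    (h2 : a ≤ 1 - 1.0572 * l) :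
    0 ≤ gapPoly 1.056 0.4705 l a := by
  obtain ⟨p, hp, h⟩ := exists_pos_of_polyCheck (ps := [[[2244375, 0, 13125000], [0, 15951250, 0, 8750000], [-2362500, 0, -28159425], [-1875000, 31060000], [-10374525, 0, -37545900], [0, 20749050], [0, 0, -23653917]],
    [[], [-2]],
    [[-1625, -2500], [5286]],
    [[-1250, 1250], [2643]]])
    (by decide +kernel) (s := l / 2) (t := a)
    (abs_le.2 ⟨by linarith, by linarith⟩) (abs_le.2 ⟨by linarith, by linarith⟩)
  simp only [List.mem_cons, List.not_mem_nil, or_false] at hp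
  rcases hp with rfl | rfl | rfl | rfl <;> simp only [polyEval₂, polyEval] at h <;> push_cast at h
  · unfold gapPoly; linarith
  all_goals linarith

theorem gapPoly_nonneg_a_97_113_113 {l a : ℝ} (hl : 0 ≤ l)
    (h1 : (-0.65) + 1.0572 * l ≤ a)
    (h2 : a ≤ 1 - 1.0572 * l) :
    0 ≤ gapPoly 1.1974 0.6385 l a := by
  obtain ⟨p, hp, h⟩ := exists_pos_of_polyCheck (ps := [[[1546125, 0, 13125000], [0, 24771250, 0, 8750000], [-5768000, 0, -38214225], [-1875000, 42820000], [-14078925, 0, -50952300], [0, 28157850], [0, 0, -32099949]],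
    [[], [-2]],
    [[-1625, -2500], [5286]],
    [[-1250, 1250], [2643]]])
    (by decide +kernel) (s := l / 2) (t := a)
    (abs_le.2 ⟨by linarith, by linarith⟩) (abs_le.2 ⟨by linarith, by linarith⟩)
  simp only [List.mem_cons, List.not_mem_nil, or_false] at hp
  rcases hp with rfl | rfl | rfl | rfl <;> simp only [polyEval₂, polyEval] at h <;> push_cast at h
  · unfold gapPoly; linarith
  all_goals linarith

theorem gapPoly_nonneg_b_80_97_80 {l a : ℝ} (hl : 0 ≤ l)
    (h1 : (-1) + 0.9166 * l ≤ a)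
    (h2 : a ≤ 1 - 0.9166 * l)
    (h3 : a ≤ -0.65 + 1.0573 * l) :
    0 ≤ gapPoly 0.9154 0.2813 l a := by
  obtain ⟨p, hp, h⟩ := exists_pos_of_polyCheck (ps := [[[17600625, 0, 65625000], [0, 30091250, 0, 43750000], [8995000, 0, -84179025], [-9375000, 89080000], [-31013325, 0, -112238700], [0, 62026650], [0, 0, -70710381]],
    [[], [-2]],
    [[-2500, -2500], [4583]],
    [[-2500, 2500], [4583]],
    [[3250, 5000], [-10573]]])
    (by decide +kernel) (s := l / 2) (t := a)
    (abs_le.2 ⟨by linarith, by linarith⟩) (abs_le.2 ⟨by linarith, by linarith⟩)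
  simp only [List.mem_cons, List.not_mem_nil, or_false] at hp
  rcases hp with rfl | rfl | rfl | rfl | rfl <;> simp only [polyEval₂, polyEval] at h <;> push_cast at h
  · unfold gapPoly; linarith
  all_goals linarith

theorem gapPoly_nonneg_b_80_97_97 {l a : ℝ} (hl : 0 ≤ l)
    (h1 : (-1) + 0.9166 * l ≤ a)
    (h2 : a ≤ 1 - 0.9166 * l)
    (h3 : a ≤ -0.65 + 1.0573 * l) :
    0 ≤ gapPoly 1.0559 0.4233 l a := by
  obtain ⟨p, hp, h⟩ := exists_pos_of_polyCheck (ps := [[[17403750, 0, 65625000], [0, 67366250, 0, 43750000], [-3561250, 0, -126672525], [-9375000, 138780000], [-46668825, 0, -168896700], [0, 93337650], [0, 0, -106404921]],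
    [[], [-2]],
    [[-2500, -2500], [4583]],
    [[-2500, 2500], [4583]],
    [[3250, 5000], [-10573]]])
    (by decide +kernel) (s := l / 2) (t := a)
    (abs_le.2 ⟨by linarith, by linarith⟩) (abs_le.2 ⟨by linarith, by linarith⟩)
  simp only [List.mem_cons, List.not_mem_nil, or_false] at hp
  rcases hp with rfl | rfl | rfl | rfl | rfl <;> simp only [polyEval₂, polyEval] at h <;> push_cast at h
  · unfold gapPoly; linarith
  all_goals linarith

theorem gapPoly_nonneg_b_97_113_97 {l a : ℝ} (hl : 0 ≤ l)
    (h1 : (-1) + 1.0572 * l ≤ a)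
    (h2 : a ≤ 1 - 1.0572 * l)
    (h3 : a ≤ -0.65 + 1.1987 * l) :
    0 ≤ gapPoly 1.056 0.4141 l a := by
  obtain ⟨p, hp, h⟩ := exists_pos_of_polyCheck (ps := [[[18624375, 0, 65625000], [0, 64951250, 0, 43750000], [-1942500, 0, -123919425], [-9375000, 135560000], [-45654525, 0, -165225900], [0, 91309050], [0, 0, -104092317]],
    [[], [-2]],
    [[-1250, -1250], [2643]],
    [[-1250, 1250], [2643]],
    [[3250, 5000], [-11987]]])
    (by decide +kernel) (s := l / 2) (t := a)
    (abs_le.2 ⟨by linarith, by linarith⟩) (abs_le.2 ⟨by linarith, by linarith⟩)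
  simp only [List.mem_cons, List.not_mem_nil, or_false] at hp
  rcases hp with rfl | rfl | rfl | rfl | rfl <;> simp only [polyEval₂, polyEval] at h <;> push_cast at h
  · unfold gapPoly; linarith
  all_goals linarith

theorem gapPoly_nonneg_b_97_113_113 {l a : ℝ} (hl : 0 ≤ l)
    (h1 : (-1) + 1.0572 * l ≤ a)
    (h2 : a ≤ 1 - 1.0572 * l)
    (h3 : a ≤ -0.65 + 1.1987 * l) :
    0 ≤ gapPoly 1.1974 0.5725 l a := by
  obtain ⟨p, hp, h⟩ := exists_pos_of_polyCheck (ps := [[[655725, 0, 2625000], [0, 4261250, 0, 1750000], [-691600, 0, -6852825], [-375000, 7640000], [-2524725, 0, -9137100], [0, 5049450], [0, 0, -5756373]],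
    [[], [-2]],
    [[-1250, -1250], [2643]],
    [[-1250, 1250], [2643]],
    [[3250, 5000], [-11987]]])
    (by decide +kernel) (s := l / 2) (t := a)
    (abs_le.2 ⟨by linarith, by linarith⟩) (abs_le.2 ⟨by linarith, by linarith⟩)
  simp only [List.mem_cons, List.not_mem_nil, or_false] at hp
  rcases hp with rfl | rfl | rfl | rfl | rfl <;> simp only [polyEval₂, polyEval] at h <;> push_cast at h
  · unfold gapPoly; linarith
  all_goals linarith

set_option maxHeartbeats 1000000 in
theorem edgePoly_pos_80_97_80 {l a : ℝ} (hl : 0 ≤ l)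
    (h1 : (-1) + 0.9166 * l ≤ a)
    (h2 : a ≤ 1 - 0.9166 * l)
    (h3 : a ≤ -0.65 + 1.0573 * l) :
    0 < edgePoly 0.9154 0.85 l a := by
  obtain ⟨p, hp, h⟩ := exists_pos_of_polyCheck (ps := [[[2943, 6750, 45000], [-6750, -28500, -6750, 15000], [1662, -61200, -105300, -74700, -4800], [21900, 97800, 167100, 122400, 21600, -9600], [-23120, -57120, -600, 144600, 182400, 81600, 10400], [6120, 12240, 6120, 33600, 134400, 201600, 134400, 33600], [-4080, -12240, -12240, -4080]],
    [[], [-2]],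
    [[-2500, -2500], [4583]],
    [[-2500, 2500], [4583]],
    [[3250, 5000], [-10573]]])
    (by decide +kernel) (s := l / 2) (t := a)
    (abs_le.2 ⟨by linarith, by linarith⟩) (abs_le.2 ⟨by linarith, by linarith⟩)
  simp only [List.mem_cons, List.not_mem_nil, or_false] at hp
  rcases hp with rfl | rfl | rfl | rfl | rfl <;> simp only [polyEval₂, polyEval] at h <;> push_cast at h
  · unfold edgePoly; linarith
  all_goals linarith

set_option maxHeartbeats 1000000 in
theorem edgePoly_pos_80_97_97 {l a : ℝ} (hl : 0 ≤ l)
    (h1 : (-1) + 0.9166 * l ≤ a)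
    (h2 : a ≤ 1 - 0.9166 * l)
    (h3 : a ≤ -0.65 + 1.0573 * l) :
    0 < edgePoly 1.0559 1.02 l a := by
  obtain ⟨p, hp, h⟩ := exists_pos_of_polyCheck (ps := [[[3231, -1800, 90000], [1800, -26400, 1800, 30000], [-8646, -163200, -241200, -159600, -9600], [54000, 216000, 344400, 244800, 43200, -19200], [-55488, -137088, -21600, 282400, 364800, 163200, 20800], [14688, 29376, 14688, 67200, 268800, 403200, 268800, 67200], [-9792, -29376, -29376, -9792]],
    [[], [-2]],
    [[-2500, -2500], [4583]],
    [[-2500, 2500], [4583]],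
    [[3250, 5000], [-10573]]])
    (by decide +kernel) (s := l / 2) (t := a)
    (abs_le.2 ⟨by linarith, by linarith⟩) (abs_le.2 ⟨by linarith, by linarith⟩)
  simp only [List.mem_cons, List.not_mem_nil, or_false] at hp
  rcases hp with rfl | rfl | rfl | rfl | rfl <;> simp only [polyEval₂, polyEval] at h <;> push_cast at h
  · unfold edgePoly; linarith
  all_goals linarith

set_option maxHeartbeats 1000000 in
theorem edgePoly_pos_97_113_97 {l a : ℝ} (hl : 0 ≤ l)
    (h1 : (-1) + 1.0572 * l ≤ a)
    (h2 : a ≤ 1 - 1.0572 * l)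
    (h3 : a ≤ -0.65 + 1.1987 * l) :
    0 < edgePoly 1.056 1.03 l a := by
  obtain ⟨p, hp, h⟩ := exists_pos_of_polyCheck (ps := [[[585, -675, 22500], [675, -6150, 675, 7500], [-2460, -41400, -60750, -40050, -2400], [13650, 54300, 86250, 61200, 10800, -4800], [-14008, -34608, -5700, 70500, 91200, 40800, 5200], [3708, 7416, 3708, 16800, 67200, 100800, 67200, 16800], [-2472, -7416, -7416, -2472]],
    [[], [-2]],
    [[-1250, -1250], [2643]],
    [[-1250, 1250], [2643]],
    [[3250, 5000], [-11987]]])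
    (by decide +kernel) (s := l / 2) (t := a)
    (abs_le.2 ⟨by linarith, by linarith⟩) (abs_le.2 ⟨by linarith, by linarith⟩)
  simp only [List.mem_cons, List.not_mem_nil, or_false] at hp
  rcases hp with rfl | rfl | rfl | rfl | rfl <;> simp only [polyEval₂, polyEval] at h <;> push_cast at h
  · unfold edgePoly; linarith
  all_goals linarith

set_option maxHeartbeats 1000000 in
theorem edgePoly_pos_97_113_113 {l a : ℝ} (hl : 0 ≤ l)
    (h1 : (-1) + 1.0572 * l ≤ a)
    (h2 : a ≤ 1 - 1.0572 * l)
    (h3 : a ≤ -0.65 + 1.1987 * l) :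
    0 < edgePoly 1.1974 1.19 l a := by
  obtain ⟨p, hp, h⟩ := exists_pos_of_polyCheck (ps := [[[333, -8550, 45000], [8550, 2100, 8550, 15000], [-10278, -102000, -135900, -84900, -4800], [32100, 118200, 177300, 122400, 21600, -9600], [-32368, -79968, -21000, 137800, 182400, 81600, 10400], [8568, 17136, 8568, 33600, 134400, 201600, 134400, 33600], [-5712, -17136, -17136, -5712]],
    [[], [-2]],
    [[-1250, -1250], [2643]],
    [[-1250, 1250], [2643]],
    [[3250, 5000], [-11987]]])
    (by decide +kernel) (s := l / 2) (t := a)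
    (abs_le.2 ⟨by linarith, by linarith⟩) (abs_le.2 ⟨by linarith, by linarith⟩)
  simp only [List.mem_cons, List.not_mem_nil, or_false] at hp
  rcases hp with rfl | rfl | rfl | rfl | rfl <;> simp only [polyEval₂, polyEval] at h <;> push_cast at h
  · unfold edgePoly; linarith
  all_goals linarith

theorem vertexPoly_nonneg_80_97 {l a : ℝ} (hl : 0 ≤ l)
    (h1 : (-1) + 0.9166 * l ≤ a)
    (h2 : a ≤ 1 - 0.9166 * l)
    (h3 : a ≤ -0.65 + 1.0573 * l)
    (h4 : a ≤ 0.175) :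
    0 ≤ vertexPoly 0.85 l a := by
  obtain ⟨p, hp, h⟩ := exists_pos_of_polyCheck (ps := [[[-45, -300], [300, 0, -300], [-30, 0, -84, -284], [0, -400, -516, 168, 284], [0, 0, -456, -1368, -1368, -456]],
    [[], [-2]],
    [[-2500, -2500], [4583]],
    [[-2500, 2500], [4583]],
    [[3250, 5000], [-10573]],
    [[-7, 40]]])
    (by decide +kernel) (s := l / 2) (t := a)
    (abs_le.2 ⟨by linarith, by linarith⟩) (abs_le.2 ⟨by linarith, by linarith⟩)
  simp only [List.mem_cons, List.not_mem_nil, or_false] at hp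
  rcases hp with rfl | rfl | rfl | rfl | rfl | rfl <;> simp only [polyEval₂, polyEval] at h <;> push_cast at h
  · unfold vertexPoly; linarith
  all_goals linarith

theorem vertexPoly_nonneg_97_113 {l a : ℝ} (hl : 0 ≤ l)
    (h1 : (-1) + 1.0572 * l ≤ a)
    (h2 : a ≤ 1 - 1.0572 * l)
    (h3 : a ≤ -0.65 + 1.1987 * l)
    (h4 : a ≤ 0.175) :
    0 ≤ vertexPoly 1.03 l a := by
  obtain ⟨p, hp, h⟩ := exists_pos_of_polyCheck (ps := [[[9, -300], [300, 0, -300], [6, 0, -84, -284], [0, -400, -516, 168, 284], [0, 0, -456, -1368, -1368, -456]],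
    [[], [-2]],
    [[-1250, -1250], [2643]],
    [[-1250, 1250], [2643]],
    [[3250, 5000], [-11987]],
    [[-7, 40]]])
    (by decide +kernel) (s := l / 2) (t := a)
    (abs_le.2 ⟨by linarith, by linarith⟩) (abs_le.2 ⟨by linarith, by linarith⟩)
  simp only [List.mem_cons, List.not_mem_nil, or_false] at hp
  rcases hp with rfl | rfl | rfl | rfl | rfl | rfl <;> simp only [polyEval₂, polyEval] at h <;> push_cast at h
  · unfold vertexPoly; linarith
  all_goals linarith

theorem gapPoly_nonneg_interp {K0 K1 K m0 m1 m q0 q1 q l a : ℝ} (h01 : K0 < K1) (h0 : K0 ≤ K)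
    (h1 : K ≤ K1)
    (hm : (K1 - K) * m0 + (K - K0) * m1 ≤ (K1 - K0) * m)
    (hq : (K1 - K0) * q ≤ (K1 - K) * q0 + (K - K0) * q1)
    (hp0 : 0 ≤ gapPoly m0 q0 l a) (hp1 : 0 ≤ gapPoly m1 q1 l a) : 0 ≤ gapPoly m q l a := by
  have hT : 0 ≤ (1 + l ^ 2 / 3 + 0.0525 * l ^ 4) * (1 - l * a + 0.57 * (l * a) ^ 2) :=
    mul_nonneg (by positivity) (by nlinarith [sq_nonneg (1 - l * a / 2 * 1.14)])
  have e0 := mul_nonneg (sub_nonneg.2 h1) hp0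
  have e1 := mul_nonneg (sub_nonneg.2 h0) hp1
  have e2 := mul_nonneg (sub_nonneg.2 hm) (show 0 ≤ 1 + l ^ 2 / 6 by positivity)
  have e3 := mul_nonneg (sub_nonneg.2 hq) hT
  refine nonneg_of_mul_nonneg_right (a := K1 - K0) ?_ (sub_pos.2 h01)
  unfold gapPoly at *
  linarith

theorem edgePoly_pos_interp {K0 K1 K m0 m1 m l a : ℝ} (h01 : K0 < K1) (h0 : K0 ≤ K)
    (h1 : K ≤ K1) (hm : (K1 - K) * m0 + (K - K0) * m1 ≤ (K1 - K0) * m)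
    (hp0 : 0 < edgePoly m0 K0 l a) (hp1 : 0 < edgePoly m1 K1 l a) :
    0 < edgePoly m K l a := by
  have e0 : 0 < (K1 - K) * edgePoly m0 K0 l a + (K - K0) * edgePoly m1 K1 l a := by
    rcases h0.eq_or_lt with rfl | h0
    · nlinarith [mul_pos (sub_pos.2 h01) hp0]
    · nlinarith [mul_pos (sub_pos.2 h0) hp1, mul_nonneg (sub_nonneg.2 h1) hp0.le]
  have e2 := mul_nonneg (sub_nonneg.2 hm) (show 0 ≤ 1 + l ^ 2 / 6 by positivity)
  refine pos_of_mul_pos_right (a := K1 - K0) ?_ (sub_pos.2 h01).le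
  unfold edgePoly at *
  linarith

theorem vertexPoly_nonneg_mono {K0 K l a : ℝ} (h0 : K0 ≤ K) (hp0 : 0 ≤ vertexPoly K0 l a) :
    0 ≤ vertexPoly K l a := by
  have e2 := mul_nonneg (sub_nonneg.2 h0) (show 0 ≤ 1 + l ^ 2 / 6 by positivity)
  unfold vertexPoly at *
  linarith

/-- The discriminant condition for the choice `e = D / S`. -/
theorem gapPoly_nonneg_of_le {K m l c : ℝ} (hK0 : 0.5 ≤ K) (hK1 : K ≤ 1.13)
    (hm0 : 0.693147 / 4 * (K + 1.5) ^ 2 ≤ m) (hm1 : m ≤ 0.693148 / 4 * (K + 1.5) ^ 2)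
    (hl : 0 ≤ l) (hc : -1 ≤ c) (hcl : c + 2 * (m * l) ≤ 1) (hKc : K ≤ 0.8 ∨ -0.65 ≤ c) :
    0 ≤ gapPoly m (K ^ 2 / 2) l (c + m * l) := by
  have hreg {t : ℝ} (ht : t ≤ m) : t * l ≤ m * l := mul_le_mul_of_nonneg_right ht hl
  rcases le_total K 0.8 with h8 | h8
  · rcases le_total K 0.65 with h6 | h6
    · have ht := hreg (t := 0.6931) (by nlinarith)
      exact gapPoly_nonneg_interp (by norm_num) hK0 h6
        (by nlinarith [sq_nonneg (K - 0.575)]) (by nlinarith)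
        (gapPoly_nonneg_a_50_65_50 hl (by linarith) (by linarith))
        (gapPoly_nonneg_a_50_65_65 hl (by linarith) (by linarith))
    · have ht := hreg (t := 0.801) (by nlinarith)
      exact gapPoly_nonneg_interp (by norm_num) h6 h8
        (by nlinarith [sq_nonneg (K - 0.725)]) (by nlinarith)
        (gapPoly_nonneg_a_65_80_65 hl (by linarith) (by linarith))
        (gapPoly_nonneg_a_65_80_80 hl (by linarith) (by linarith))
  · have hc' : -0.65 ≤ c ∨ K = 0.8 := hKc.symm.imp_right fun h => le_antisymm h h8
    rcases hc' with hc' | rfl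
    · rcases le_total K 0.97 with h6 | h6
      · have ht := hreg (t := 0.9166) (by nlinarith)
        exact gapPoly_nonneg_interp (by norm_num) h8 h6
          (by nlinarith [sq_nonneg (K - 0.885)]) (by nlinarith)
          (gapPoly_nonneg_a_80_97_80 hl (by linarith) (by linarith))
          (gapPoly_nonneg_a_80_97_97 hl (by linarith) (by linarith))
      · have ht := hreg (t := 1.0572) (by nlinarith)
        exact gapPoly_nonneg_interp (by norm_num) h6 hK1
          (by nlinarith [sq_nonneg (K - 1.05)]) (by nlinarith)
          (gapPoly_nonneg_a_97_113_97 hl (by linarith) (by linarith))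
          (gapPoly_nonneg_a_97_113_113 hl (by linarith) (by linarith))
    · have ht := hreg (t := 0.801) (by nlinarith)
      exact gapPoly_nonneg_interp (K0 := 0.65) (K1 := 0.8) (by norm_num) (by norm_num) le_rfl
        (by norm_num; linarith) (by norm_num)
        (gapPoly_nonneg_a_65_80_65 hl (by linarith) (by linarith))
        (gapPoly_nonneg_a_65_80_80 hl (by linarith) (by linarith))

/-- The polynomial conditions for the choice `e = D / S - η`. -/
theorem exists_shift_polys_nonneg {K m l c : ℝ} (hK0 : 0.8 ≤ K) (hK1 : K ≤ 1.13)
    (hm0 : 0.693147 / 4 * (K + 1.5) ^ 2 ≤ m) (hm1 : m ≤ 0.693148 / 4 * (K + 1.5) ^ 2)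
    (hl : 0 ≤ l) (hc : -1 ≤ c) (hcl : c + 2 * (m * l) ≤ 1) (hc1 : c ≤ -0.65) :
    ∃ η : ℝ, 0 ≤ η ∧ η ≤ 0.06 ∧ 0 ≤ gapPoly m ((K - η) ^ 2 / 2) l (c + m * l) ∧
      0 < edgePoly m (K + η) l (c + m * l) ∧ 0 ≤ vertexPoly (K + η) l (c + m * l) := by
  have hreg {t : ℝ} (ht : t ≤ m) : t * l ≤ m * l := mul_le_mul_of_nonneg_right ht hl
  have hreg' {t : ℝ} (ht : m ≤ t) : m * l ≤ t * l := mul_le_mul_of_nonneg_right ht hl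
  rcases le_total K 0.97 with h6 | h6
  · have ht := hreg (t := 0.9166) (by nlinarith)
    have ht' := hreg' (t := 1.0573) (by nlinarith)
    refine ⟨0.05, by norm_num, by norm_num, ?_, ?_, ?_⟩
    · exact gapPoly_nonneg_interp (by norm_num) hK0 h6
          (by nlinarith [sq_nonneg (K - 0.885)]) (by nlinarith)
        (gapPoly_nonneg_b_80_97_80 hl (by linarith) (by linarith) (by linarith))
        (gapPoly_nonneg_b_80_97_97 hl (by linarith) (by linarith) (by linarith))
    · exact edgePoly_pos_interp (by norm_num) (by linarith) (by linarith)
        (by nlinarith [sq_nonneg (K - 0.885)])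
        (edgePoly_pos_80_97_80 hl (by linarith) (by linarith) (by linarith))
        (edgePoly_pos_80_97_97 hl (by linarith) (by linarith) (by linarith))
    · exact vertexPoly_nonneg_mono (by linarith) (vertexPoly_nonneg_80_97 hl (by linarith)
        (by linarith) (by linarith) (by linarith))
  · have ht := hreg (t := 1.0572) (by nlinarith)
    have ht' := hreg' (t := 1.1987) (by nlinarith)
    refine ⟨0.06, by norm_num, by norm_num, ?_, ?_, ?_⟩
    · exact gapPoly_nonneg_interp (by norm_num) h6 hK1
          (by nlinarith [sq_nonneg (K - 1.05)]) (by nlinarith)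
        (gapPoly_nonneg_b_97_113_97 hl (by linarith) (by linarith) (by linarith))
        (gapPoly_nonneg_b_97_113_113 hl (by linarith) (by linarith) (by linarith))
    · exact edgePoly_pos_interp (by norm_num) (by linarith) (by linarith)
        (by nlinarith [sq_nonneg (K - 1.05)])
        (edgePoly_pos_97_113_97 hl (by linarith) (by linarith) (by linarith))
        (edgePoly_pos_97_113_113 hl (by linarith) (by linarith) (by linarith))
    · exact vertexPoly_nonneg_mono (by linarith) (vertexPoly_nonneg_97_113 hl (by linarith)
        (by linarith) (by linarith) (by linarith))

theorem abs_exp_sub_taylor_le {x : ℝ} (hx : |x| ≤ 4) :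
    |exp x - (1 + x + x ^ 2 / 2 + x ^ 3 / 6 + x ^ 4 / 24 + x ^ 5 / 120 + x ^ 6 / 720 +
      x ^ 7 / 5040)| ≤ x ^ 8 / 20160 := by
  have h := Complex.exp_bound' (x := (x : ℂ)) (n := 8) (by
    rw [Complex.norm_real, Real.norm_eq_abs]; norm_num; linarith)
  rw [Complex.norm_real, Real.norm_eq_abs] at h
  have e : Complex.exp (x : ℂ) - ∑ m ∈ range 8, (x : ℂ) ^ m / (m.factorial : ℂ) =
      ((exp x - (1 + x + x ^ 2 / 2 + x ^ 3 / 6 + x ^ 4 / 24 + x ^ 5 / 120 + x ^ 6 / 720 +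
      x ^ 7 / 5040) : ℝ) : ℂ) := by
    simp only [sum_range_succ, range_zero, sum_empty, Nat.factorial]
    push_cast
    ring
  rw [e, Complex.norm_real, Real.norm_eq_abs, Even.pow_abs (by decide)] at h
  refine h.trans (le_of_eq ?_)
  norm_num [Nat.factorial]
  ring

theorem sinh_le_taylor {l : ℝ} (hl : 0 ≤ l) (hl1 : l ≤ 1.45) :
    sinh l ≤ l + l ^ 3 / 6 + l ^ 5 / 112 := by
  have h1 := (abs_le.1 (abs_exp_sub_taylor_le (x := l) (abs_le.2 ⟨by linarith, by linarith⟩))).2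
  have h2 := (abs_le.1 (abs_exp_sub_taylor_le (x := -l) (abs_le.2 ⟨by linarith, by linarith⟩))).1
  rw [sinh_eq]
  have : 0 ≤ l ^ 5 * (1 / 112 - 1 / 120 - l ^ 2 / 5040 - l ^ 3 / 20160) := by
    refine mul_nonneg (by positivity) ?_
    have h2 : l ^ 2 ≤ 1.45 ^ 2 := by gcongr
    have h3 : l ^ 3 ≤ 1.45 ^ 3 := by gcongr
    norm_num at h2 h3
    linarith
  linarith

theorem taylor_le_sinh {l : ℝ} (hl : 0 ≤ l) (hl1 : l ≤ 1.45) : l + l ^ 3 / 6 ≤ sinh l := by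
  have h1 := (abs_le.1 (abs_exp_sub_taylor_le (x := l) (abs_le.2 ⟨by linarith, by linarith⟩))).1
  have h2 := (abs_le.1 (abs_exp_sub_taylor_le (x := -l) (abs_le.2 ⟨by linarith, by linarith⟩))).2
  rw [sinh_eq]
  have : 0 ≤ l ^ 5 * (1 / 120 - l ^ 3 / 20160) := by
    refine mul_nonneg (by positivity) ?_
    have h3 : l ^ 3 ≤ 1.45 ^ 3 := by gcongr
    norm_num at h3
    linarith
  have : 0 ≤ l ^ 7 := by positivity
  linarith

theorem exp_neg_le_taylor {l : ℝ} (hl : 0 ≤ l) (hl1 : l ≤ 1.45) :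
    exp (-l) ≤ 1 - l + l ^ 2 / 2 - l ^ 3 / 6 + l ^ 4 / 24 := by
  have h2 := (abs_le.1 (abs_exp_sub_taylor_le (x := -l) (abs_le.2 ⟨by linarith, by linarith⟩))).2
  have : 0 ≤ l ^ 5 * (1 / 120 - l / 720 - l ^ 3 / 20160) := by
    refine mul_nonneg (by positivity) ?_
    have h3 : l ^ 3 ≤ 1.45 ^ 3 := by gcongr
    norm_num at h3
    linarith
  have : 0 ≤ l ^ 7 := by positivity
  linarith

theorem exp_neg_ge_taylor {l : ℝ} (hl : 0 ≤ l) (hl1 : l ≤ 1.45) :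
    1 - l + l ^ 2 / 2 - l ^ 3 / 6 ≤ exp (-l) := by
  have h2 := (abs_le.1 (abs_exp_sub_taylor_le (x := -l) (abs_le.2 ⟨by linarith, by linarith⟩))).1
  have : 0 ≤ l ^ 4 * (1 / 24 - l / 120 - l ^ 3 / 5040 - l ^ 4 / 20160) := by
    refine mul_nonneg (by positivity) ?_
    have h3 : l ^ 3 ≤ 1.45 ^ 3 := by gcongr
    have h4 : l ^ 4 ≤ 1.45 ^ 4 := by gcongr
    norm_num at h3 h4
    linarith
  have : 0 ≤ l ^ 6 := by positivity
  linarith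

theorem taylor_le_exp {v : ℝ} (hv : |v| ≤ 0.37) : 1 + v + v ^ 2 / 2 + v ^ 3 / 6 ≤ exp v := by
  have h2 := (abs_le.1 (abs_exp_sub_taylor_le (hv.trans (by norm_num)))).1
  obtain ⟨h0, h1⟩ := abs_le.1 hv
  have : 0 ≤ v ^ 4 * (1 / 24 + v / 120 + v ^ 2 / 720 + v ^ 3 / 5040 - v ^ 4 / 20160) := by
    refine mul_nonneg (by positivity) ?_
    have h3 := pow_le_pow_left₀ (abs_nonneg v) hv 3
    have h4 := pow_le_pow_left₀ (abs_nonneg v) hv 4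
    rw [← abs_pow] at h3 h4
    have h5 := abs_le.1 h3
    have h6 := abs_le.1 h4
    norm_num at h5 h6
    linarith [sq_nonneg v]
  linarith

theorem exp_le_quadratic {v : ℝ} (hv : |v| ≤ 0.37) : exp v ≤ 1 + v + 0.57 * v ^ 2 := by
  have h2 := (abs_le.1 (abs_exp_sub_taylor_le (hv.trans (by norm_num)))).2
  have : 0 ≤ v ^ 2 * (0.07 - v / 6 - v ^ 2 / 24 - v ^ 3 / 120 - v ^ 4 / 720 - v ^ 5 / 5040 -
      v ^ 6 / 20160) := by
    refine mul_nonneg (by positivity) ?_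
    have b (k : ℕ) := pow_le_pow_left₀ (abs_nonneg v) hv k
    have h1 := (abs_le.1 hv).2
    have h2 := b 2
    have h3 := b 3
    have h4 := b 4
    have h5 := b 5
    have h6 := b 6
    simp only [← abs_pow] at h2 h3 h4 h5 h6
    replace h2 := (abs_le.1 h2).2
    replace h3 := (abs_le.1 h3).2
    replace h4 := (abs_le.1 h4).2
    replace h5 := (abs_le.1 h5).2
    replace h6 := (abs_le.1 h6).2
    norm_num at h2 h3 h4 h5 h6 ⊢
    linarith
  linarith

theorem le_one_sub_exp_mul {x : ℝ} (hx : 0 ≤ x) (hx1 : x ≤ 1.1) :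
    2 * x * (1 - x ^ 2 / 3 + 0.14 * x ^ 3) ≤ (1 - exp (-x)) * (3 - exp (-x)) := by
  have h2 := (abs_le.1 (abs_exp_sub_taylor_le (x := -x) (abs_le.2 ⟨by linarith, by linarith⟩))).2
  have h1 := (abs_le.1 (abs_exp_sub_taylor_le (x := -2 * x) (abs_le.2 ⟨by linarith, by linarith⟩))).1
  have e : exp (-2 * x) = exp (-x) * exp (-x) := by rw [← exp_add]; ring_nf
  rw [e] at h1
  have : 0 ≤ x ^ 4 * (0.22 - (32 / 120 - 4 / 120) * x + 60 / 720 * x ^ 2 - 124 / 5040 * x ^ 3 -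
      260 / 20160 * x ^ 4) := by
    refine mul_nonneg (by positivity) ?_
    nlinarith [mul_nonneg hx hx, pow_nonneg hx 3]
  linarith

/-- The first condition: the parabola for `z₊` (or for both signs if `η = 0`) has a nonpositive
discriminant. -/
theorem sq_mul_sinh_sq_le {m q l a : ℝ} (hq : 0 ≤ q) (hl : 0 ≤ l) (hl1 : l ≤ 1.45)
    (hm : 0 ≤ m) (ha : -1 ≤ a) (hv : |l * a| ≤ 0.37) (h : 0 ≤ gapPoly m q l a) :
    q * sinh l ^ 2 ≤
      exp (l * a) * (exp (l * a) - cosh l - (a - m * l) * sinh l) := by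
  have hS := sinh_le_taylor hl hl1
  have hS' := taylor_le_sinh hl hl1
  have hS0 : 0 ≤ sinh l := sinh_nonneg_iff.2 hl
  have hE := exp_neg_le_taylor hl hl1
  have hU := taylor_le_exp hv
  have hU' := exp_le_quadratic (v := -(l * a)) (by rwa [abs_neg])
  have hC : cosh l = exp (-l) + sinh l := by rw [← cosh_sub_sinh]; ring
  have hS2 : sinh l ^ 2 ≤ l ^ 2 * (1 + l ^ 2 / 3 + 0.0525 * l ^ 4) := by
    calc sinh l ^ 2 ≤ (l + l ^ 3 / 6 + l ^ 5 / 112) ^ 2 := by gcongr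
      _ ≤ _ := by
        have : 0 ≤ l ^ 6 * (0.0525 - 1 / 36 - 1 / 56 - l ^ 2 / 336 - l ^ 4 / 12544) := by
          refine mul_nonneg (by positivity) ?_
          have h2 : l ^ 2 ≤ 1.45 ^ 2 := by gcongr
          have h4 : l ^ 4 ≤ 1.45 ^ 4 := by gcongr
          norm_num at h2 h4 ⊢
          linarith
        linarith
  have key : q * (sinh l ^ 2 * exp (-(l * a))) ≤
      exp (l * a) - cosh l - (a - m * l) * sinh l := by
    have e1 : q * (sinh l ^ 2 * exp (-(l * a))) ≤ q * (l ^ 2 * (1 + l ^ 2 / 3 + 0.0525 * l ^ 4) *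
        (1 - l * a + 0.57 * (l * a) ^ 2)) := by
      gcongr
      linarith
    have e2 := mul_le_mul_of_nonneg_left hS (show 0 ≤ 1 + a by linarith)
    have e3 := mul_le_mul_of_nonneg_left hS' (mul_nonneg hm hl)
    have e4 := mul_nonneg (sq_nonneg l) h
    unfold gapPoly at e4
    rw [hC]
    linarith
  calc q * sinh l ^ 2 = exp (l * a) * (q * (sinh l ^ 2 * exp (-(l * a)))) := by
        rw [exp_neg]; field_simp
    _ ≤ _ := mul_le_mul_of_nonneg_left key (exp_pos _).le

/-- The second condition: positivity of the parabola for `z₋` at the left end of the range. -/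
theorem edge_condition {m K l a : ℝ} (hK : 0 ≤ K) (hl : 0 < l) (hl1 : l ≤ 1.45)
    (hm : 0 ≤ m) (ha : -1 ≤ a) (hv : |l * a| ≤ 0.37) (hx : l * (1 + a) ≤ 1.1)
    (h : 0 < edgePoly m K l a) :
    2 * (1 + a - m * l) * sinh l * exp (l * a) < (exp (l * a) - exp (-l)) *
      (2 * exp (l * a) + (exp (l * a) - exp (-l)) - 2 * (sinh l * K)) := by
  have hx0 : 0 ≤ l * (1 + a) := mul_nonneg hl.le (by linarith)
  have hS := sinh_le_taylor hl.le hl1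
  have hS' := taylor_le_sinh hl.le hl1
  have hS0 : 0 ≤ sinh l := sinh_nonneg_iff.2 hl.le
  have hU := taylor_le_exp hv
  have hE : exp (-l) = exp (l * a) * exp (-(l * (1 + a))) := by rw [← exp_add]; ring_nf
  have hf := le_one_sub_exp_mul hx0 hx
  have hE3 := exp_neg_ge_taylor hx0 (hx.trans (by norm_num))
  set x := l * (1 + a) with hxdef
  set E := exp (-x) with hEdef
  set U := exp (l * a) with hUdef
  have hE1 : E ≤ 1 := exp_le_one_iff.2 (by linarith)
  have hU0 : 0 < U := exp_pos _
  have hS2 : sinh l ≤ l * (1 + l ^ 2 / 6 + l ^ 4 / 100) := by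
    have : 0 ≤ l ^ 5 := by positivity
    linarith
  have key : 2 * (1 + a - m * l) * sinh l < (1 - E) * (U * (3 - E) - 2 * (sinh l * K)) := by
    have e1 : (1 + l * a + (l * a) ^ 2 / 2 + (l * a) ^ 3 / 6) *
        (2 * x * (1 - x ^ 2 / 3 + 0.14 * x ^ 3)) ≤ U * ((1 - E) * (3 - E)) := by
      refine mul_le_mul hU hf (mul_nonneg (by linarith) ?_) hU0.le
      nlinarith [pow_nonneg hx0 3]
    have e2 : K * (sinh l * (1 - E)) ≤
        K * (l * (1 + l ^ 2 / 6 + l ^ 4 / 100) * (x - x ^ 2 / 2 + x ^ 3 / 6)) := by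
      gcongr
      · linarith
    have e3 := mul_le_mul_of_nonneg_left hS2 (show 0 ≤ 1 + a by linarith)
    have e4 := mul_le_mul_of_nonneg_left hS' (mul_nonneg hm hl.le)
    have e5 := mul_pos (pow_pos hl 2) h
    unfold edgePoly at e5
    rw [hxdef] at e1 e2
    linarith
  rw [hE]
  calc 2 * (1 + a - m * l) * sinh l * U < (1 - E) * (U * (3 - E) - 2 * (sinh l * K)) * U :=
        mul_lt_mul_of_pos_right key hU0
    _ = _ := by ring

/-- The third condition: the vertex of the parabola for `z₋` lies left of the range. -/
theorem vertex_condition {K l a : ℝ} (hK : 0 ≤ K) (hl : 0 ≤ l) (hl1 : l ≤ 1.45)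
    (ha : -1 ≤ a) (hv : |l * a| ≤ 0.37) (hx : l * (1 + a) ≤ 1.1)
    (h : 0 ≤ vertexPoly K l a) : exp (l * a) - exp (-l) ≤ sinh l * K := by
  have hx0 : 0 ≤ l * (1 + a) := mul_nonneg hl (by linarith)
  have hS' := taylor_le_sinh hl hl1
  have hU := exp_le_quadratic hv
  have hE : exp (-l) = exp (l * a) * exp (-(l * (1 + a))) := by rw [← exp_add]; ring_nf
  have hE3 := exp_neg_ge_taylor hx0 (hx.trans (by norm_num))
  have hE1 : exp (-(l * (1 + a))) ≤ 1 := exp_le_one_iff.2 (by linarith)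
  have e1 : exp (l * a) * (1 - exp (-(l * (1 + a)))) ≤ (1 + l * a + 0.57 * (l * a) ^ 2) *
      (l * (1 + a) - (l * (1 + a)) ^ 2 / 2 + (l * (1 + a)) ^ 3 / 6) := by
    refine mul_le_mul hU (by linarith) (by linarith) ((exp_pos _).le.trans hU)
  have e2 := mul_le_mul_of_nonneg_right hS' hK
  have e3 := mul_nonneg hl h
  unfold vertexPoly at e3
  rw [hE]
  linarith

theorem parabola_identity (U J S z g ρ : ℝ)
    (hz : z * S = (U + J) / 2 + (U - J) + g * S) :
    2 * S * (U * (z + ρ / 2) - (z - ρ / 2) * (J + ρ * S)) =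
      (S * ρ - (U - J) - g * S) ^ 2 + 2 * U * (U - J) - g ^ 2 * S ^ 2 := by
  linear_combination (2 * (U - J) - 2 * S * ρ) * hz

theorem parabola_nonneg_of_sq_le {U J S z g ρ : ℝ} (hS : 0 < S)
    (hz : z * S = (U + J) / 2 + (U - J) + g * S) (hg : g ^ 2 * S ^ 2 ≤ 2 * U * (U - J)) :
    (z - ρ / 2) * (J + ρ * S) ≤ U * (z + ρ / 2) := by
  have h := parabola_identity U J S z g ρ hz
  have : 0 ≤ 2 * S * (U * (z + ρ / 2) - (z - ρ / 2) * (J + ρ * S)) := by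
    rw [h]; nlinarith [sq_nonneg (S * ρ - (U - J) - g * S)]
  linarith [nonneg_of_mul_nonneg_right this (by positivity : 0 < 2 * S)]

theorem parabola_nonneg_of_edge {U J S z k q ρ : ℝ} (hS : 0 < S)
    (hz : z * S = (U + J) / 2 + (U - J) - k * S) (hρ : -q ≤ ρ)
    (hvertex : U - J + q * S ≤ S * k)
    (hedge : 2 * q * S * U ≤ (U - J + q * S) * (2 * U + (U - J + q * S) - 2 * (S * k))) :
    (z - ρ / 2) * (J + ρ * S) ≤ U * (z + ρ / 2) := by
  have h := parabola_identity U J S z (-k) ρ (by linarith)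
  have : 0 ≤ 2 * S * (U * (z + ρ / 2) - (z - ρ / 2) * (J + ρ * S)) := by
    rw [h]
    have h1 : 0 ≤ S * (ρ + q) := mul_nonneg hS.le (by linarith)
    nlinarith [mul_nonneg h1 (sub_nonneg.2 hvertex), mul_nonneg h1 h1]
  linarith [nonneg_of_mul_nonneg_right this (by positivity : 0 < 2 * S)]

theorem pos_of_parabola_nonneg {U J S z q ρ : ℝ} (hU : 0 < U) (hS : 0 < S) (hz : 0 < z)
    (hρ : -q ≤ ρ) (hJ : 0 < J - q * S) (h : (z - ρ / 2) * (J + ρ * S) ≤ U * (z + ρ / 2)) :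
    0 < z + ρ / 2 := by
  rcases le_total 0 ρ with h0 | h0
  · linarith
  · have h1 : 0 < J + ρ * S := by nlinarith
    have h2 : 0 < (z - ρ / 2) * (J + ρ * S) := mul_pos (by linarith) h1
    exact pos_of_mul_pos_right (h2.trans_le h) hU.le

set_option maxHeartbeats 1000000 in
/-- The shifted potential used in the dual argument. -/
theorem exists_potential_shift {K m l c : ℝ} (hK0 : 0.5 ≤ K) (hK1 : K ≤ 1.13)
    (hm0 : 0.693147 / 4 * (K + 1.5) ^ 2 ≤ m) (hm1 : m ≤ 0.693148 / 4 * (K + 1.5) ^ 2)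
    (hl : 0 < l) (hc : -1 ≤ c) (hcl : c + 2 * (m * l) ≤ 1) :
    ∃ z₀ : ℝ, ∀ g ρ : ℝ, |g| ≤ K → -(1 + c) ≤ ρ →
      (z₀ + g - ρ / 2) * (cosh l + c * sinh l + ρ * sinh l) ≤
        exp (l * (c + m * l)) * (z₀ + g + ρ / 2) ∧ 0 < z₀ + g + ρ / 2 := by
  have hm : 0.6931 ≤ m := by nlinarith
  have hml : 0 < m * l := by positivity
  have hl1 : l ≤ 1.45 := by nlinarith
  have hquad : m * (l * (1 - m * l)) ≤ 1 / 4 := by nlinarith [sq_nonneg (1 - 2 * (m * l))]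
  have hlml : l * (1 - m * l) ≤ 0.37 := by
    by_contra! h
    nlinarith
  have hv : |l * (c + m * l)| ≤ 0.37 := by
    rw [abs_mul, abs_of_pos hl]
    refine (mul_le_mul_of_nonneg_left ?_ hl.le).trans hlml
    exact abs_le.2 ⟨by linarith, by linarith⟩
  have ha : -1 ≤ c + m * l := by linarith
  have hS : 0 < sinh l := sinh_pos_iff.2 hl
  have hE : cosh l = exp (-l) + sinh l := by rw [← cosh_sub_sinh]; ring
  have hE0 := exp_pos (-l)
  set U := exp (l * (c + m * l)) with hUdef
  have hU : 0 < U := exp_pos _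
  set S := sinh l with hSdef
  set J := cosh l + c * S with hJdef
  have hJ : 0 < J - (1 + c) * S := by rw [hJdef, hE]; linarith
  have hJ0 : 0 < J := by nlinarith
  by_cases hcase : K ≤ 0.8 ∨ -0.65 ≤ c
  · have h := sq_mul_sinh_sq_le (by positivity) hl.le hl1 (by linarith) ha hv
      (gapPoly_nonneg_of_le hK0 hK1 hm0 hm1 hl.le hc hcl hcase)
    have h' : K ^ 2 * S ^ 2 ≤ 2 * U * (U - J) := by
      rw [hJdef]
      linarith
    refine ⟨((U + J) / 2 + (U - J)) / S, fun g ρ hg hρ => ?_⟩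
    have hg2 : g ^ 2 * S ^ 2 ≤ K ^ 2 * S ^ 2 := by
      gcongr 1
      exact sq_le_sq' (by linarith [neg_abs_le g]) ((le_abs_self g).trans hg)
    have hz : (((U + J) / 2 + (U - J)) / S + g) * S = (U + J) / 2 + (U - J) + g * S := by
      field_simp
    have hpar := parabola_nonneg_of_sq_le hS hz (hg2.trans h') (ρ := ρ)
    refine ⟨hpar, pos_of_parabola_nonneg hU hS ?_ hρ hJ hpar⟩
    refine pos_of_mul_pos_left (b := S) ?_ hS.le
    rw [hz]
    by_contra! hneg
    have h1 : 2 * U + (U - J) ≤ 2 * (-(g * S)) := by linarith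
    have hD : 0 ≤ U - J := nonneg_of_mul_nonneg_right (a := 2 * U)
      ((by positivity : 0 ≤ K ^ 2 * S ^ 2).trans h') (by positivity)
    have h2 := mul_self_le_mul_self (by positivity) h1
    have h3 : 0 < (U + J) ^ 2 := by positivity
    linarith
  · push Not at hcase
    obtain ⟨η, hη0, hη1, hp1, hp2, hp3⟩ :=
      exists_shift_polys_nonneg hcase.1.le hK1 hm0 hm1 hl.le hc hcl hcase.2.le
    have hm' : 0.9166 ≤ m := by nlinarith [hcase.1]
    have hx : l * (1 + (c + m * l)) ≤ 1.1 := by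
      have h1 : l * (1 + (c + m * l)) ≤ l * (2 - m * l) := by gcongr; linarith
      refine h1.trans ?_
      by_contra! h
      nlinarith [sq_nonneg (1 - m * l)]
    have h1 := sq_mul_sinh_sq_le (by positivity) hl.le hl1 (by linarith) ha hv hp1
    have h2 := edge_condition (by linarith) hl hl1 (by linarith) ha hv hx hp2
    have h3 := vertex_condition (by linarith) hl.le hl1 ha hv hx hp3
    have hV : U - exp (-l) = U - J + (1 + c) * S := by rw [hJdef, hE]; ring
    rw [show 1 + (c + m * l) - m * l = 1 + c by ring, ← hSdef, ← hUdef] at h2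
    rw [← hSdef, ← hUdef] at h3
    have h1' : (K - η) ^ 2 * S ^ 2 ≤ 2 * U * (U - J) := by
      rw [hJdef]
      linarith
    have hD : 0 ≤ U - J := nonneg_of_mul_nonneg_right (a := 2 * U)
      ((by positivity : 0 ≤ (K - η) ^ 2 * S ^ 2).trans h1') (by positivity)
    have hzlo : 0 < 2 * U + (U - J) - 2 * (S * (K + η)) := by
      have hq : 0 ≤ (1 + c) * S := mul_nonneg (by linarith) hS.le
      have hV0 : 0 ≤ U - exp (-l) := by rw [hV]; linarith
      by_contra! hneg
      have h4 : 2 * U + (U - exp (-l)) - 2 * (S * (K + η)) ≤ (1 + c) * S := by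
        rw [hV]; linarith
      have h5 := mul_le_mul_of_nonneg_left h4 hV0
      have h6 : 0 ≤ (1 + c) * S * U := mul_nonneg hq hU.le
      have h7 : 0 ≤ (1 + c) * S * exp (-l) := mul_nonneg hq hE0.le
      linarith
    rw [hV] at h2 h3
    set z₀ := ((U + J) / 2 + (U - J)) / S - η with hz₀
    have hz₀S : z₀ * S = (U + J) / 2 + (U - J) - η * S := by rw [hz₀]; field_simp
    refine ⟨z₀, fun g ρ hg hρ => ?_⟩
    obtain ⟨hg0, hg1⟩ := abs_le.1 hg
    have hlo := parabola_nonneg_of_edge (z := z₀ - K) (k := K + η) hS (by linarith) hρ h3 h2.le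
    have hhi := parabola_nonneg_of_sq_le (z := z₀ + K) (g := K - η) (ρ := ρ) hS (by linarith) h1'
    have hpar : (z₀ + g - ρ / 2) * (J + ρ * S) ≤ U * (z₀ + g + ρ / 2) := by
      have e1 := mul_le_mul_of_nonneg_left hlo (show 0 ≤ K - g by linarith)
      have e2 := mul_le_mul_of_nonneg_left hhi (show 0 ≤ K + g by linarith)
      refine le_of_mul_le_mul_left (a := 2 * K) ?_ (by linarith)
      linarith
    refine ⟨hpar, pos_of_parabola_nonneg hU hS ?_ hρ hJ hpar⟩
    refine pos_of_mul_pos_left (b := S) ?_ hS.le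
    have : -K * S ≤ g * S := by gcongr
    linarith

section StochasticMatrix

variable {X : Type*} [Fintype X] {Q : Matrix X X ℝ} {p : X → ℝ}

theorem mulVec_sq_le (hQ0 : ∀ x y, 0 ≤ Q x y) (hQ1 : ∀ x, ∑ y, Q x y = 1) (f : X → ℝ) (x : X) :
    (Q *ᵥ f) x ^ 2 ≤ (Q *ᵥ fun y => f y ^ 2) x := by
  simpa [mulVec, dotProduct] using (even_two.convexOn_pow (𝕜 := ℝ)).map_sum_le (t := univ)
    (w := Q x) (p := f) (fun y _ => hQ0 x y) (hQ1 x) fun _ _ => Set.mem_univ _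

theorem dotProduct_mulVec_of_stationary (hst : p ᵥ* Q = p) (f : X → ℝ) :
    p ⬝ᵥ (Q *ᵥ f) = p ⬝ᵥ f := by
  rw [dotProduct_mulVec, hst]

theorem nonneg_of_eq_add_mulVec (hQ0 : ∀ x y, 0 ≤ Q x y) (hQ1 : ∀ x, ∑ y, Q x y = 1)
    {s : ℝ} (hs0 : 0 ≤ s) (hs1 : s < 1) {e f : X → ℝ} (he : ∀ x, 0 ≤ e x)
    (h : ∀ x, f x = e x + s * (Q *ᵥ f) x) (x : X) : 0 ≤ f x := by
  obtain ⟨x₀, -, hmin⟩ := exists_min_image univ f ⟨x, mem_univ x⟩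
  have h1 : f x₀ ≤ (Q *ᵥ f) x₀ := by
    calc f x₀ = ∑ y, Q x₀ y * f x₀ := by rw [← sum_mul, hQ1, one_mul]
      _ ≤ (Q *ᵥ f) x₀ :=
        sum_le_sum fun y _ => mul_le_mul_of_nonneg_left (hmin y (mem_univ y)) (hQ0 x₀ y)
  have h2 := h x₀
  have h3 : 0 ≤ f x₀ := by nlinarith [he x₀, mul_le_mul_of_nonneg_left h1 hs0]
  exact h3.trans (hmin x (mem_univ x))

end StochasticMatrix

section FundamentalMatrix

variable {X : Type*} [Fintype X] [DecidableEq X] {Q : Matrix X X ℝ} {p : X → ℝ}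

/-- The matrix `I - Q + e p'` whose inverse is the fundamental matrix. -/
noncomputable def fundamentalInv (Q : Matrix X X ℝ) (p : X → ℝ) : Matrix X X ℝ :=
  1 - Q + vecMulVec (fun _ => (1 : ℝ)) p

theorem fundamentalInv_mulVec (Q : Matrix X X ℝ) (p f : X → ℝ) (x : X) :
    (fundamentalInv Q p *ᵥ f) x = f x - (Q *ᵥ f) x + p ⬝ᵥ f := by
  simp [fundamentalInv, add_mulVec, sub_mulVec, vecMulVec_mulVec]

theorem vecMul_fundamentalInv (hp1 : ∑ x, p x = 1) (hst : p ᵥ* Q = p) :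
    p ᵥ* fundamentalInv Q p = p := by
  have h : p ⬝ᵥ (fun _ : X => (1 : ℝ)) = 1 := by simpa [dotProduct] using hp1
  simp [fundamentalInv, vecMul_add, vecMul_sub, hst, vecMul_vecMulVec, h]

theorem fundamentalInv_mulVec_one (hQ1 : ∀ x, ∑ y, Q x y = 1) (hp1 : ∑ x, p x = 1) :
    fundamentalInv Q p *ᵥ (fun _ => 1) = fun _ => 1 := by
  ext x
  rw [fundamentalInv_mulVec]
  simp [mulVec, dotProduct, hQ1, hp1]

theorem dotProduct_fundamental_mulVec (hinv : IsUnit (fundamentalInv Q p).det)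
    (hp1 : ∑ x, p x = 1) (hst : p ᵥ* Q = p) (f : X → ℝ) :
    p ⬝ᵥ ((fundamentalInv Q p)⁻¹ *ᵥ f) = p ⬝ᵥ f := by
  have h := dotProduct_mulVec p (fundamentalInv Q p) ((fundamentalInv Q p)⁻¹ *ᵥ f)
  rwa [vecMul_fundamentalInv hp1 hst, mulVec_mulVec, mul_nonsing_inv _ hinv, one_mulVec, eq_comm] at h

/-- The Poisson equation. -/
theorem mulVec_fundamental_mulVec (hinv : IsUnit (fundamentalInv Q p).det)
    (hp1 : ∑ x, p x = 1) (hst : p ᵥ* Q = p) (f : X → ℝ) (x : X) :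
    (Q *ᵥ ((fundamentalInv Q p)⁻¹ *ᵥ f)) x =
      ((fundamentalInv Q p)⁻¹ *ᵥ f) x - f x + p ⬝ᵥ f := by
  have h := fundamentalInv_mulVec Q p ((fundamentalInv Q p)⁻¹ *ᵥ f) x
  rw [mulVec_mulVec, mul_nonsing_inv _ hinv, one_mulVec,
    dotProduct_fundamental_mulVec hinv hp1 hst] at h
  linarith

theorem fundamental_mulVec_one (hinv : IsUnit (fundamentalInv Q p).det)
    (hQ1 : ∀ x, ∑ y, Q x y = 1) (hp1 : ∑ x, p x = 1) :
    (fundamentalInv Q p)⁻¹ *ᵥ (fun _ => 1) = fun _ => 1 := by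
  conv_lhs => rw [← fundamentalInv_mulVec_one hQ1 hp1]
  rw [mulVec_mulVec, nonsing_inv_mul _ hinv, one_mulVec]

/-- For a positive stationary mass, the diagonal entry is controlled by the energy identity. -/
theorem half_le_fundamental_diag_of_pos (hQ0 : ∀ x y, 0 ≤ Q x y) (hQ1 : ∀ x, ∑ y, Q x y = 1)
    (hp0 : ∀ x, 0 ≤ p x) (hp1 : ∑ x, p x = 1) (hst : p ᵥ* Q = p)
    (hinv : IsUnit (fundamentalInv Q p).det) {x : X} (hx : 0 < p x) :
    1 / 2 ≤ (fundamentalInv Q p)⁻¹ x x := by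
  set e : X → ℝ := Pi.single x 1
  set f := (fundamentalInv Q p)⁻¹ *ᵥ e with hf
  have hfx : f x = (fundamentalInv Q p)⁻¹ x x := by simp [hf, e]
  have hpe : p ⬝ᵥ e = p x := by simp [e]
  have hpf : p ⬝ᵥ f = p x := by rw [hf, dotProduct_fundamental_mulVec hinv hp1 hst, hpe]
  have hQf : ∀ y, (Q *ᵥ f) y = f y - e y + p x := fun y => by
    rw [hf, mulVec_fundamental_mulVec hinv hp1 hst, hpe]
  have h1 : ∑ y, p y * (Q *ᵥ f) y ^ 2 ≤ ∑ y, p y * f y ^ 2 :=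
    (sum_le_sum fun y _ => mul_le_mul_of_nonneg_left (mulVec_sq_le hQ0 hQ1 f y) (hp0 y)).trans_eq
      (dotProduct_mulVec_of_stationary hst fun y => f y ^ 2)
  have h2 : ∑ y, p y * (Q *ᵥ f) y ^ 2 = ∑ y, p y * f y ^ 2 + p x - p x ^ 2 + 2 * p x ^ 2
      - 2 * p x * f x - 2 * p x ^ 2 + 2 * p x ^ 2 := by
    have : ∀ y, p y * (Q *ᵥ f) y ^ 2 = p y * f y ^ 2 + p y * (e y) ^ 2 + p x ^ 2 * p y
        - 2 * (p y * (f y * e y)) + 2 * p x * (p y * f y) - 2 * p x * (p y * e y) := fun y => by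
      rw [hQf]; ring
    simp only [this, sum_add_distrib, sum_sub_distrib, ← mul_sum]
    have e1 : ∑ y, p y * f y = p x := hpf
    have e2 : ∑ y, p y * e y = p x := hpe
    rw [e1, e2, hp1]
    have e3 : ∑ y, p y * e y ^ 2 = p x := by simp [e, Pi.single_apply]
    have e4 : ∑ y, p y * (f y * e y) = p x * f x := by simp [e, Pi.single_apply]
    rw [e3, e4]
    ring
  rw [← hfx]
  nlinarith

/-- For a transient state, the diagonal entry is a limit of discounted occupation times. -/
theorem one_le_fundamental_diag_of_eq_zero (hQ0 : ∀ x y, 0 ≤ Q x y)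
    (hQ1 : ∀ x, ∑ y, Q x y = 1) (hp1 : ∑ x, p x = 1) (hst : p ᵥ* Q = p)
    (hinv : IsUnit (fundamentalInv Q p).det) {x : X} (hx : p x = 0) :
    1 ≤ (fundamentalInv Q p)⁻¹ x x := by
  let N : ℝ → Matrix X X ℝ := fun s => fundamentalInv (s • Q) (s • p)
  have hN1 : N 1 = fundamentalInv Q p := by simp [N]
  have hNc : Continuous N := by
    unfold N fundamentalInv
    refine continuous_matrix fun i j => ?_
    simp only [Matrix.add_apply, Matrix.sub_apply, vecMulVec_apply, Matrix.smul_apply,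
      Pi.smul_apply]
    fun_prop
  have hdet : (N 1).det ≠ 0 := by rw [hN1]; exact hinv.ne_zero
  have hcont : ContinuousAt (fun s => (N s)⁻¹ x x) 1 := by
    have : ∀ s, (N s)⁻¹ x x = ((N s).det)⁻¹ * (N s).adjugate x x := fun s => by
      simp [Matrix.inv_def, Ring.inverse_eq_inv]
    simp only [this]
    exact (hNc.matrix_det.continuousAt.inv₀ hdet).mul
      (hNc.matrix_adjugate.matrix_elem x x).continuousAt
  rw [← hN1]
  refine ge_of_tendsto (hcont.tendsto.mono_left (nhdsWithin_le_nhds (s := Set.Iio 1))) ?_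
  filter_upwards [nhdsWithin_le_nhds (hNc.matrix_det.continuousAt.eventually_ne hdet),
    nhdsWithin_le_nhds (lt_mem_nhds (zero_lt_one' ℝ)), self_mem_nhdsWithin] with s hs hs0 hs1
  have hs1 : s < 1 := hs1
  set f := (N s)⁻¹ *ᵥ Pi.single x 1 with hf
  have hfx : f x = (N s)⁻¹ x x := by simp [hf]
  have heq : ∀ y, f y - s * (Q *ᵥ f) y + s * (p ⬝ᵥ f) = (Pi.single x 1 : X → ℝ) y := fun y => by
    have := fundamentalInv_mulVec (s • Q) (s • p) f y
    rw [show fundamentalInv (s • Q) (s • p) *ᵥ f = Pi.single x 1 by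
      rw [hf, mulVec_mulVec]
      change (N s * (N s)⁻¹) *ᵥ _ = _
      rw [mul_nonsing_inv _ hs.isUnit, one_mulVec]] at this
    rw [this]
    simp [smul_mulVec]
  have hpf : p ⬝ᵥ f = 0 := by
    have h1 : ∑ y, p y * (f y - s * (Q *ᵥ f) y + s * (p ⬝ᵥ f)) = 0 := by
      simp [heq, Pi.single_apply, hx]
    have h2 : ∀ y, p y * (f y - s * (Q *ᵥ f) y + s * (p ⬝ᵥ f)) =
        p y * f y - s * (p y * (Q *ᵥ f) y) + s * (p ⬝ᵥ f) * p y := fun y => by ring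
    simp only [h2, sum_add_distrib, sum_sub_distrib, ← mul_sum, hp1] at h1
    have h3 : ∑ y, p y * (Q *ᵥ f) y = p ⬝ᵥ f := dotProduct_mulVec_of_stationary hst f
    rw [h3] at h1
    have h4 : ∑ y, p y * f y = p ⬝ᵥ f := rfl
    rw [h4] at h1
    linarith
  have heq' : ∀ y, f y = (Pi.single x 1 : X → ℝ) y + s * (Q *ᵥ f) y := fun y => by
    rw [← heq, hpf]; ring
  have hnn := nonneg_of_eq_add_mulVec hQ0 hQ1 hs0.le hs1
    (fun y => by by_cases h : y = x <;> simp [h]) heq'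
  rw [← hfx, heq' x, Pi.single_eq_same]
  have : 0 ≤ (Q *ᵥ f) x := sum_nonneg fun y _ => mul_nonneg (hQ0 x y) (hnn y)
  nlinarith [mul_nonneg hs0.le this]

theorem half_le_fundamental_diag (hQ0 : ∀ x y, 0 ≤ Q x y) (hQ1 : ∀ x, ∑ y, Q x y = 1)
    (hp0 : ∀ x, 0 ≤ p x) (hp1 : ∑ x, p x = 1) (hst : p ᵥ* Q = p)
    (hinv : IsUnit (fundamentalInv Q p).det) (x : X) :
    1 / 2 ≤ (fundamentalInv Q p)⁻¹ x x := by
  rcases (hp0 x).lt_or_eq with h | h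
  · exact half_le_fundamental_diag_of_pos hQ0 hQ1 hp0 hp1 hst hinv h
  · linarith [one_le_fundamental_diag_of_eq_zero hQ0 hQ1 hp1 hst hinv h.symm]

/-- The solution of the Poisson equation, centred by half the reward. -/
theorem abs_fundamental_mulVec_sub_half_le {Z : Matrix X X ℝ} {r : X → ℝ} {B : ℝ}
    (hr : ∀ x, |r x| ≤ 1) (x : X) (hdiag : 1 / 2 ≤ Z x x) (hB : ∑ y, |Z x y| ≤ B) :
    |(Z *ᵥ r) x - r x / 2| ≤ B - 1 / 2 := by
  have h1 : (Z *ᵥ r) x - r x / 2 = ∑ y, (Z x y - if y = x then 1 / 2 else 0) * r y := by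
    simp [mulVec, dotProduct, sub_mul]
    ring
  have h2 : ∀ y, |Z x y - if y = x then 1 / 2 else 0| = |Z x y| - if y = x then 1 / 2 else 0 := by
    intro y
    split_ifs with h
    · subst h
      rw [abs_of_nonneg (by linarith), abs_of_nonneg (by linarith)]
    · simp
  calc |(Z *ᵥ r) x - r x / 2|
      ≤ ∑ y, |(Z x y - if y = x then 1 / 2 else 0) * r y| := by
        rw [h1]; exact abs_sum_le_sum_abs _ _
    _ ≤ ∑ y, (|Z x y| - if y = x then 1 / 2 else 0) := by
        refine sum_le_sum fun y _ => ?_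
        rw [abs_mul, ← h2]
        exact mul_le_of_le_one_right (abs_nonneg _) (hr y)
    _ = ∑ y, |Z x y| - 1 / 2 := by simp
    _ ≤ B - 1 / 2 := by linarith

end FundamentalMatrix

section KLDivergence

variable {X A : Type*} [Fintype X] [Fintype A]

theorem sum_mul_exp_pos {q : A → ℝ} (hq0 : ∀ a, 0 ≤ q a) (hq1 : ∑ a, q a = 1) (F : A → ℝ) :
    0 < ∑ a, q a * exp (F a) := by
  obtain ⟨a, ha, hne⟩ := exists_ne_zero_of_sum_ne_zero (hq1.trans_ne one_ne_zero)
  exact sum_pos' (fun a _ => mul_nonneg (hq0 a) (exp_pos _).le)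
    ⟨a, ha, mul_pos (lt_of_le_of_ne (hq0 a) (Ne.symm hne)) (exp_pos _)⟩

/-- The Gibbs variational inequality. -/
theorem sum_mul_le_kl_add_log {p q : A → ℝ} (hp0 : ∀ a, 0 ≤ p a) (hp1 : ∑ a, p a = 1)
    (hq0 : ∀ a, 0 ≤ q a) (hq1 : ∑ a, q a = 1) (hac : ∀ a, 0 < p a → 0 < q a) (F : A → ℝ) :
    ∑ a, p a * F a ≤ ∑ a, p a * log (p a / q a) + log (∑ a, q a * exp (F a)) := by
  set W := ∑ a, q a * exp (F a) with hW
  have hWpos : 0 < W := sum_mul_exp_pos hq0 hq1 F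
  have key : ∀ a, p a * (F a - log (p a / q a) - log W) ≤ q a * exp (F a) / W - p a := by
    intro a
    rcases (hp0 a).eq_or_lt with h | h
    · rw [← h]
      have := hq0 a
      simp only [zero_mul, sub_zero]
      positivity
    · have hq := hac a h
      have hlog : log (q a * exp (F a) / (W * p a)) = F a - log (p a / q a) - log W := by
        rw [log_div (by positivity) (by positivity), log_mul hq.ne' (exp_pos _).ne', log_exp,
          log_mul hWpos.ne' h.ne', log_div h.ne' hq.ne']
        ring
      have hle := log_le_sub_one_of_pos (show 0 < q a * exp (F a) / (W * p a) by positivity)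
      rw [hlog] at hle
      refine (mul_le_mul_of_nonneg_left hle h.le).trans_eq ?_
      field_simp
  have hsum := sum_le_sum fun a (_ : a ∈ univ) => key a
  simp only [mul_sub, sum_sub_distrib, ← sum_mul, ← sum_div, hp1] at hsum
  rw [← hW, div_self hWpos.ne'] at hsum
  linarith

/-- Averaged Gibbs variational inequality. -/
theorem sum_sum_mul_le_kl_add_log {p : X → ℝ} {μ ν : X → A → ℝ} {ε : ℝ} (hp0 : ∀ x, 0 ≤ p x)
    (hμ0 : ∀ x a, 0 ≤ μ x a) (hμ1 : ∀ x, ∑ a, μ x a = 1)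
    (hν0 : ∀ x a, 0 ≤ ν x a) (hν1 : ∀ x, ∑ a, ν x a = 1)
    (hac : ∀ x a, 0 < μ x a → 0 < ν x a)
    (hKL : ∑ x, p x * ∑ a, μ x a * log (μ x a / ν x a) ≤ ε) (F : X → A → ℝ) :
    ∑ x, p x * ∑ a, μ x a * F x a ≤ ε + ∑ x, p x * log (∑ a, ν x a * exp (F x a)) := by
  have := sum_le_sum fun x (_ : x ∈ univ) => mul_le_mul_of_nonneg_left
    (sum_mul_le_kl_add_log (hμ0 x) (hμ1 x) (hν0 x) (hν1 x) (hac x) (F x)) (hp0 x)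
  simp only [mul_add, sum_add_distrib] at this
  linarith

/-- The chord bound for the exponential on `[-l, l]`. -/
theorem exp_mul_le_cosh_add_sinh {l r : ℝ} (hr : |r| ≤ 1) :
    exp (l * r) ≤ cosh l + r * sinh l := by
  obtain ⟨h1, h2⟩ := abs_le.1 hr
  have := convexOn_exp.2 (Set.mem_univ l) (Set.mem_univ (-l))
    (show 0 ≤ (1 + r) / 2 by linarith) (show 0 ≤ (1 - r) / 2 by linarith) (by ring)
  simp only [smul_eq_mul] at this
  rw [show (1 + r) / 2 * l + (1 - r) / 2 * -l = l * r by ring] at this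
  rw [cosh_eq, sinh_eq]
  linarith

theorem sum_mul_exp_le_cosh_add_sinh {q f : A → ℝ} (hq0 : ∀ a, 0 ≤ q a) (hq1 : ∑ a, q a = 1)
    (hf : ∀ a, |f a| ≤ 1) (l : ℝ) :
    ∑ a, q a * exp (l * f a) ≤ cosh l + (∑ a, q a * f a) * sinh l := by
  calc ∑ a, q a * exp (l * f a) ≤ ∑ a, q a * (cosh l + f a * sinh l) :=
        sum_le_sum fun a _ => mul_le_mul_of_nonneg_left (exp_mul_le_cosh_add_sinh (hf a)) (hq0 a)
    _ = cosh l + (∑ a, q a * f a) * sinh l := by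
        simp only [mul_add, sum_add_distrib, ← sum_mul, hq1, one_mul, ← mul_assoc]

/-- Hoeffding's lemma for a bounded function on a finite probability space. -/
theorem log_sum_mul_exp_le {q f : A → ℝ} (hq0 : ∀ a, 0 ≤ q a) (hq1 : ∑ a, q a = 1)
    (hf : ∀ a, |f a| ≤ 1) (l : ℝ) :
    log (∑ a, q a * exp (l * f a)) ≤ l * ∑ a, q a * f a + l ^ 2 / 2 := by
  let _ : MeasurableSpace A := ⊤
  let ν : MeasureTheory.Measure A := ∑ a, ENNReal.ofReal (q a) • MeasureTheory.Measure.dirac a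
  have hint : ∀ F : A → ℝ, ∫ a, F a ∂ν = ∑ a, q a * F a := fun F => by
    rw [MeasureTheory.integral_finsetSum_measure fun a _ =>
      (MeasureTheory.integrable_dirac (by simp)).smul_measure ENNReal.ofReal_ne_top]
    simp [MeasureTheory.integral_smul_measure, ENNReal.toReal_ofReal, hq0]
  have : MeasureTheory.IsProbabilityMeasure ν := ⟨by
    simp [ν, ← ENNReal.ofReal_sum_of_nonneg, hq0, hq1]⟩
  have h := (ProbabilityTheory.hasSubgaussianMGF_of_mem_Icc (X := f) (μ := ν) (a := -1) (b := 1)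
    (measurable_from_top.aemeasurable) (.of_forall fun a => abs_le.1 (hf a))).mgf_le l
  rw [ProbabilityTheory.mgf, hint, hint] at h
  have hexp : ∑ a, q a * exp (l * (f a - ∑ a, q a * f a)) =
      (∑ a, q a * exp (l * f a)) * exp (-(l * ∑ a, q a * f a)) := by
    rw [sum_mul]
    refine sum_congr rfl fun a _ => ?_
    rw [mul_assoc, ← exp_add]
    ring_nf
  rw [hexp] at h
  have h2 := log_le_log (mul_pos (sum_mul_exp_pos hq0 hq1 _) (exp_pos _)) h
  rw [log_mul (sum_mul_exp_pos hq0 hq1 _).ne' (exp_pos _).ne', log_exp, log_exp] at h2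
  norm_num at h2
  linarith

end KLDivergence

/-- The relative entropy of `p` with respect to `q` is at most `δ`, in variational form. -/
def EntropyLE {X : Type*} [Fintype X] (p q : X → ℝ) (δ : ℝ) : Prop :=
  ∀ f : X → ℝ, p ⬝ᵥ f ≤ δ + log (q ⬝ᵥ fun x => exp (f x))

theorem le_sqrt_of_forall_mul_le {D δ : ℝ} (h : ∀ l : ℝ, l * D ≤ δ + l ^ 2 / 2) :
    D ≤ √(2 * δ) := by
  refine le_sqrt_of_sq_le ?_
  have := h D
  linarith

section EntropyPath

variable {X A : Type*} [Fintype X] [Fintype A]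

theorem entropyLE_self {p : X → ℝ} (hp0 : ∀ x, 0 ≤ p x) (hp1 : ∑ x, p x = 1) :
    EntropyLE p p 0 := fun f => by
  have := sum_mul_le_kl_add_log hp0 hp1 hp0 hp1 (fun _ h => h) f
  have h0 : ∑ x, p x * log (p x / p x) = 0 := sum_eq_zero fun x _ => by
    by_cases h : p x = 0 <;> simp [h]
  rwa [h0] at this

theorem EntropyLE.dotProduct_sub_le {p q f : X → ℝ} {δ B : ℝ} (h : EntropyLE p q δ)
    (hq0 : ∀ x, 0 ≤ q x) (hq1 : ∑ x, q x = 1) (hB : 0 < B) (hf : ∀ x, |f x| ≤ B) :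
    p ⬝ᵥ f - q ⬝ᵥ f ≤ √(2 * δ) * B := by
  rw [← div_le_iff₀ hB]
  refine le_sqrt_of_forall_mul_le fun l => ?_
  have h1 := h fun x => l * (f x / B)
  have h2 := log_sum_mul_exp_le hq0 hq1 (f := fun x => f x / B)
    (fun x => by rw [abs_div, abs_of_pos hB, div_le_one hB]; exact hf x) l
  have e1 : p ⬝ᵥ (fun x => l * (f x / B)) = l * (p ⬝ᵥ f / B) := by
    simp only [dotProduct, sum_div, mul_sum]
    exact sum_congr rfl fun _ _ => by ring
  have e2 : ∑ x, q x * (f x / B) = q ⬝ᵥ f / B := by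
    simp only [dotProduct, sum_div, mul_div_assoc]
  rw [e1] at h1
  rw [e2] at h2
  have h3 := h1.trans (add_le_add_right h2 δ)
  rw [sub_div]
  linarith

theorem mulVec_exp_pos {Q : Matrix X X ℝ} (hQ0 : ∀ x y, 0 ≤ Q x y) (hQ1 : ∀ x, ∑ y, Q x y = 1)
    (f : X → ℝ) (x : X) : 0 < (Q *ᵥ fun y => exp (f y)) x :=
  sum_mul_exp_pos (hQ0 x) (hQ1 x) f

theorem EntropyLE.vecMul {p q : X → ℝ} {Q : Matrix X X ℝ} {δ ε : ℝ} (h : EntropyLE p q δ)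
    (hQ0 : ∀ x y, 0 ≤ Q x y) (hQ1 : ∀ x, ∑ y, Q x y = 1)
    (hstep : ∀ f : X → ℝ, p ⬝ᵥ f ≤ ε + p ⬝ᵥ fun x => log ((Q *ᵥ fun y => exp (f y)) x)) :
    EntropyLE p (q ᵥ* Q) (δ + ε) := fun f => by
  have h1 := h fun x => log ((Q *ᵥ fun y => exp (f y)) x)
  simp only [exp_log (mulVec_exp_pos hQ0 hQ1 f _)] at h1
  rw [← dotProduct_mulVec]
  linarith [hstep f]

theorem vecMul_nonneg {q : X → ℝ} {Q : Matrix X X ℝ} (hq0 : ∀ x, 0 ≤ q x)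
    (hQ0 : ∀ x y, 0 ≤ Q x y) (x : X) : 0 ≤ (q ᵥ* Q) x :=
  sum_nonneg fun y _ => mul_nonneg (hq0 y) (hQ0 y x)

theorem sum_vecMul {q : X → ℝ} {Q : Matrix X X ℝ} (hq1 : ∑ x, q x = 1)
    (hQ1 : ∀ x, ∑ y, Q x y = 1) : ∑ x, (q ᵥ* Q) x = 1 := by
  simp only [Matrix.vecMul, dotProduct]
  rw [sum_comm]
  simp [← mul_sum, hQ1, hq1]

/-- Transfer of the average reward along an entropy bound. -/
theorem EntropyLE.reward_sub_le {p q : X → ℝ} {ν R : X → A → ℝ} {δ ε c : ℝ}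
    (h : EntropyLE p q δ) (hq0 : ∀ x, 0 ≤ q x) (hq1 : ∑ x, q x = 1)
    (hν0 : ∀ x a, 0 ≤ ν x a) (hν1 : ∀ x, ∑ a, ν x a = 1) (hR : ∀ x a, |R x a| ≤ 1)
    (hrew : ∀ l : ℝ, l * c ≤ ε + p ⬝ᵥ fun x => log (∑ a, ν x a * exp (l * R x a))) :
    c - q ⬝ᵥ (fun x => ∑ a, ν x a * R x a) ≤ √(2 * (δ + ε)) := by
  refine le_sqrt_of_forall_mul_le fun l => ?_
  have h1 := h fun x => log (∑ a, ν x a * exp (l * R x a))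
  simp only [exp_log (sum_mul_exp_pos (hν0 _) (hν1 _) _)] at h1
  have h2 := log_sum_mul_exp_le (A := X × A) (q := fun z => q z.1 * ν z.1 z.2)
    (f := fun z => R z.1 z.2) (fun z => mul_nonneg (hq0 _) (hν0 _ _))
    (by simp [Fintype.sum_prod_type, ← mul_sum, hν1, hq1]) (fun z => hR _ _) l
  simp only [Fintype.sum_prod_type, mul_assoc, ← mul_sum] at h2
  have h3 := hrew l
  simp only [dotProduct] at h1 h3 ⊢
  linarith

/-- Regret bound from the first two steps of the chain. -/
theorem two_mul_regret_le {p : X → ℝ} {Q : Matrix X X ℝ} {ν R : X → A → ℝ} {g r : X → ℝ}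
    {ε rs c K : ℝ} (hp0 : ∀ x, 0 ≤ p x) (hp1 : ∑ x, p x = 1)
    (hQ0 : ∀ x y, 0 ≤ Q x y) (hQ1 : ∀ x, ∑ y, Q x y = 1)
    (hν0 : ∀ x a, 0 ≤ ν x a) (hν1 : ∀ x, ∑ a, ν x a = 1) (hR : ∀ x a, |R x a| ≤ 1)
    (hr : ∀ x, r x = ∑ a, ν x a * R x a)
    (hrew : ∀ l : ℝ, l * rs ≤ ε + p ⬝ᵥ fun x => log (∑ a, ν x a * exp (l * R x a)))
    (hstep : ∀ f : X → ℝ, p ⬝ᵥ f ≤ ε + p ⬝ᵥ fun x => log ((Q *ᵥ fun y => exp (f y)) x))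
    (hK : 0 < K) (hg : ∀ x, |g x| ≤ K)
    (hpoisson : ∀ x, g x - (Q *ᵥ g) x = (r x + (Q *ᵥ r) x) / 2 - c) :
    2 * (rs - c) ≤ √(2 * ε) * (1 / 2 + √2 + √3 / 2 + √2 * K) := by
  have H0 := entropyLE_self hp0 hp1
  have H1 := H0.vecMul hQ0 hQ1 hstep
  have H2 := H1.vecMul hQ0 hQ1 hstep
  have q0 := vecMul_nonneg hp0 hQ0
  have q1 := sum_vecMul hp1 hQ1
  have q0' := vecMul_nonneg q0 hQ0
  have q1' := sum_vecMul q1 hQ1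
  have b0 := H0.reward_sub_le hp0 hp1 hν0 hν1 hR hrew
  have b1 := H1.reward_sub_le q0 q1 hν0 hν1 hR hrew
  have b2 := H2.reward_sub_le q0' q1' hν0 hν1 hR hrew
  have bg := H2.dotProduct_sub_le q0' q1' hK hg
  rw [show 2 * (0 + ε) = 2 * ε by ring] at b0
  rw [show 2 * (0 + ε + ε) = 2 * (2 * ε) by ring, sqrt_mul two_pos.le] at b1 bg
  rw [show 2 * (0 + ε + ε + ε) = 3 * (2 * ε) by ring, sqrt_mul three_pos.le] at b2
  simp only [← funext hr] at b0 b1 b2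
  rw [← dotProduct_mulVec] at b1
  rw [← dotProduct_mulVec, ← dotProduct_mulVec] at b2 bg
  have e : ∀ q : X → ℝ, ∑ x, q x = 1 →
      q ⬝ᵥ g - q ⬝ᵥ Q *ᵥ g = (q ⬝ᵥ r + q ⬝ᵥ Q *ᵥ r) / 2 - c := fun q hq => by
    have h1 : ∑ x, q x * (g x - (Q *ᵥ g) x) = ∑ x, ((q x * r x + q x * (Q *ᵥ r) x) / 2 - q x * c) :=
      sum_congr rfl fun x _ => by rw [hpoisson]; ring
    simp only [mul_sub, sum_sub_distrib, ← sum_div, sum_add_distrib, ← sum_mul, hq, one_mul] at h1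
    exact h1
  have e0 := e p hp1
  have e1 := e (p ᵥ* Q) q1
  simp only [← dotProduct_mulVec] at e1
  linarith

end EntropyPath

section DualBound

variable {X A : Type*} [Fintype X] [Fintype A]

/-- Averages of square roots against the joint law of an action and the next state. -/
theorem sum_mul_exp_add_half_log_le {q f u : A → ℝ} {C U : ℝ} (hq0 : ∀ a, 0 ≤ q a)
    (l : ℝ) (hu : ∀ a, 0 < u a) (hC : ∑ a, q a * exp (l * f a) ≤ C)
    (hU : ∑ a, q a * u a ≤ U) :
    ∑ a, q a * exp (l / 2 * f a + log (u a) / 2) ≤ √(C * U) := by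
  refine le_sqrt_of_sq_le ?_
  have e : ∀ a, q a * exp (l / 2 * f a + log (u a) / 2) =
      √(q a * exp (l * f a)) * √(q a * u a) := fun a => by
    rw [← sqrt_mul (mul_nonneg (hq0 a) (exp_pos _).le), mul_mul_mul_comm, sqrt_mul (by
      exact mul_nonneg (hq0 a) (hq0 a)), sqrt_mul_self (hq0 a)]
    congr 1
    nth_rw 2 [← exp_log (hu a)]
    rw [← exp_add, ← exp_half]
    congr 1
    ring
  have hcs := sum_mul_sq_le_sq_mul_sq univ (fun a => √(q a * exp (l * f a)))
    (fun a => √(q a * u a))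
  simp only [sq_sqrt (mul_nonneg (hq0 _) (exp_pos _).le),
    sq_sqrt (mul_nonneg (hq0 _) (hu _).le), ← e] at hcs
  refine hcs.trans (mul_le_mul hC hU ?_ ?_)
  · exact sum_nonneg fun a _ => mul_nonneg (hq0 a) (hu a).le
  · exact (sum_nonneg fun a _ => mul_nonneg (hq0 a) (exp_pos _).le).trans hC

theorem sum_mul_log_le {w u : X → ℝ} (hw0 : ∀ x, 0 ≤ w x) (hw1 : ∑ x, w x = 1)
    (hu : ∀ x, 0 < u x) : ∑ x, w x * log (u x) ≤ log (∑ x, w x * u x) := by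
  simpa using strictConcaveOn_log_Ioi.concaveOn.le_map_sum (t := univ) (w := w) (p := u)
    (fun x _ => hw0 x) hw1 fun x _ => hu x

/-- Dual certificate: a positive function `u` with `(cosh l + r sinh l) (Q u) ≤ e ^ v u` controls
the average reward under `p`. -/
theorem half_mul_reward_le {P : X → A → X → ℝ} {p r u : X → ℝ} {μ ν R : X → A → ℝ}
    {ε l v : ℝ} (hP0 : ∀ x a y, 0 ≤ P x a y) (hP1 : ∀ x a, ∑ y, P x a y = 1)
    (hp0 : ∀ x, 0 ≤ p x) (hp1 : ∑ x, p x = 1)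
    (hν0 : ∀ x a, 0 ≤ ν x a) (hν1 : ∀ x, ∑ a, ν x a = 1) (hR : ∀ x a, |R x a| ≤ 1)
    (hr : ∀ x, r x = ∑ a, ν x a * R x a)
    (hst : ∀ f : X → ℝ, ∑ x, p x * ∑ a, μ x a * ∑ y, P x a y * f y = ∑ x, p x * f x)
    (hDV : ∀ F : X → A → ℝ,
      ∑ x, p x * ∑ a, μ x a * F x a ≤ ε + ∑ x, p x * log (∑ a, ν x a * exp (F x a)))
    (hu : ∀ x, 0 < u x)
    (hcert : ∀ x, (cosh l + r x * sinh l) * ∑ a, ν x a * ∑ y, P x a y * u y ≤ exp v * u x) :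
    l / 2 * ∑ x, p x * ∑ a, μ x a * R x a ≤ ε + v / 2 := by
  have hPu : ∀ x a, 0 < ∑ y, P x a y * u y := fun x a => by
    simpa only [exp_log (hu _)] using sum_mul_exp_pos (hP0 x a) (hP1 x a) fun y => log (u y)
  have h1 : ∀ x, log (∑ a, ν x a * exp (l / 2 * R x a + (∑ y, P x a y * log (u y)) / 2)) ≤
      (v + log (u x)) / 2 := fun x => by
    rw [le_div_iff₀ two_pos, ← log_exp v, ← log_mul (exp_pos _).ne' (hu x).ne', mul_comm,
      ← Nat.cast_two, ← log_pow]
    have hpos := sum_mul_exp_pos (hν0 x) (hν1 x)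
      fun a => l / 2 * R x a + (∑ y, P x a y * log (u y)) / 2
    refine log_le_log (pow_pos hpos 2) ?_
    have h2 : ∑ a, ν x a * exp (l / 2 * R x a + (∑ y, P x a y * log (u y)) / 2) ≤
        √((cosh l + r x * sinh l) * ∑ a, ν x a * ∑ y, P x a y * u y) := by
      refine (sum_le_sum fun a _ => mul_le_mul_of_nonneg_left (exp_le_exp.2 ?_) (hν0 x a)).trans
        (sum_mul_exp_add_half_log_le (f := R x) (hν0 x) l (hPu x) ?_ le_rfl)
      · have := sum_mul_log_le (hP0 x a) (hP1 x a) hu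
        linarith
      · rw [hr]
        exact sum_mul_exp_le_cosh_add_sinh (hν0 x) (hν1 x) (hR x) l
    refine le_trans ((le_sqrt' hpos).1 h2) (hcert x)
  have h2 := hDV fun x a => l / 2 * R x a + (∑ y, P x a y * log (u y)) / 2
  have h3 := sum_le_sum fun x (_ : x ∈ univ) => mul_le_mul_of_nonneg_left (h1 x) (hp0 x)
  have h4 : ∑ x, p x * ∑ a, μ x a * (l / 2 * R x a + (∑ y, P x a y * log (u y)) / 2) =
      l / 2 * ∑ x, p x * ∑ a, μ x a * R x a + (∑ x, p x * log (u x)) / 2 := by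
    rw [← hst fun y => log (u y)]
    simp only [mul_sum, sum_div, ← sum_add_distrib]
    refine sum_congr rfl fun x _ => sum_congr rfl fun a _ => ?_
    simp only [mul_add, mul_sum]
    congr 1
    · ring
    · exact sum_congr rfl fun y _ => by ring
  have h5 : ∑ x, p x * ((v + log (u x)) / 2) = v / 2 + (∑ x, p x * log (u x)) / 2 := by
    have : ∀ x, p x * ((v + log (u x)) / 2) = p x * (v / 2) + p x * log (u x) / 2 :=
      fun x => by ring
    simp only [this, sum_add_distrib, ← sum_mul, ← sum_div, hp1, one_mul]
  rw [h4] at h2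
  rw [h5] at h3
  linarith

/-- The one-sided regret bound for rewards in `[-1, 1]`. -/
theorem average_reward_sub_le [DecidableEq X] [Nonempty X] {P : X → A → X → ℝ}
    (hP0 : ∀ x a y, 0 ≤ P x a y) (hP1 : ∀ x a, ∑ y, P x a y = 1) {μ ν : X → A → ℝ}
    (hμ0 : ∀ x a, 0 ≤ μ x a) (hμ1 : ∀ x, ∑ a, μ x a = 1)
    (hν0 : ∀ x a, 0 ≤ ν x a) (hν1 : ∀ x, ∑ a, ν x a = 1)
    (hac : ∀ x a, 0 < μ x a → 0 < ν x a) {Q' Q : Matrix X X ℝ}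
    (hQ' : ∀ x y, Q' x y = ∑ a, μ x a * P x a y) (hQ : ∀ x y, Q x y = ∑ a, ν x a * P x a y)
    {p q : X → ℝ} (hp0 : ∀ x, 0 ≤ p x) (hp1 : ∑ x, p x = 1)
    (hq0 : ∀ x, 0 ≤ q x) (hq1 : ∑ x, q x = 1) (hstp : p ᵥ* Q' = p) (hstq : q ᵥ* Q = q)
    (hinv : IsUnit (fundamentalInv Q q).det) {κ : ℝ}
    (hκ : ∀ x, ∑ y, |(fundamentalInv Q q)⁻¹ x y| ≤ κ) {R : X → A → ℝ} (hR : ∀ x a, |R x a| ≤ 1)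
    {ε : ℝ} (hKL : ∑ x, p x * ∑ a, μ x a * log (μ x a / ν x a) ≤ ε) :
    (∑ x, p x * ∑ a, μ x a * R x a) - (∑ x, q x * ∑ a, ν x a * R x a) ≤
      √(2 * ε * log 2) * (1 + κ) := by
  have hDV := sum_sum_mul_le_kl_add_log hp0 hμ0 hμ1 hν0 hν1 hac hKL
  have hQ0 : ∀ x y, 0 ≤ Q x y := fun x y => by
    rw [hQ]; exact sum_nonneg fun a _ => mul_nonneg (hν0 x a) (hP0 x a y)
  have hmul : ∀ {w : X → A → ℝ} {T : Matrix X X ℝ}, (∀ x y, T x y = ∑ a, w x a * P x a y) →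
      ∀ (f : X → ℝ) x, (T *ᵥ f) x = ∑ a, w x a * ∑ y, P x a y * f y := fun hT f x => by
    simp only [mulVec, dotProduct, hT, sum_mul, mul_sum, mul_assoc]
    exact sum_comm
  have hQ1 : ∀ x, ∑ y, Q x y = 1 := fun x => by
    have := hmul hQ (fun _ => 1) x
    simpa [mulVec, dotProduct, hP1, hν1] using this
  have hst : ∀ f : X → ℝ, ∑ x, p x * ∑ a, μ x a * ∑ y, P x a y * f y = ∑ x, p x * f x := fun f => by
    simp only [← hmul hQ']
    exact dotProduct_mulVec_of_stationary hstp f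
  have hbdd : ∀ {w : X → A → ℝ}, (∀ x a, 0 ≤ w x a) → (∀ x, ∑ a, w x a = 1) →
      ∀ x, |∑ a, w x a * R x a| ≤ 1 := fun h0 h1 x => by
    refine (abs_sum_le_sum_abs _ _).trans ((sum_le_sum fun a _ => ?_).trans_eq (h1 x))
    rw [abs_mul, abs_of_nonneg (h0 x a)]
    exact mul_le_of_le_one_right (h0 x a) (hR x a)
  set rs := ∑ x, p x * ∑ a, μ x a * R x a with hrs
  set r : X → ℝ := fun x => ∑ a, ν x a * R x a with hr
  set c := ∑ x, q x * r x with hc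
  have hr1 : ∀ x, |r x| ≤ 1 := hbdd hν0 hν1
  have hrs1 : rs ≤ 1 := by
    refine (sum_le_sum fun x _ => ?_).trans_eq hp1
    exact mul_le_of_le_one_right (hp0 x) (abs_le.1 (hbdd hμ0 hμ1 x)).2
  have hc1 : -1 ≤ c := by
    have := sum_le_sum fun x (_ : x ∈ univ) =>
      mul_le_mul_of_nonneg_left (abs_le.1 (hr1 x)).1 (hq0 x)
    simpa [hq1] using this
  set Z := (fundamentalInv Q q)⁻¹
  set g : X → ℝ := fun x => (Z *ᵥ r) x - r x / 2 with hg
  obtain ⟨K, rfl⟩ : ∃ K, κ = K + 1 / 2 := ⟨κ - 1 / 2, by ring⟩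
  have hgK : ∀ x, |g x| ≤ K := fun x => by
    simpa using abs_fundamental_mulVec_sub_half_le hr1 x
      (half_le_fundamental_diag hQ0 hQ1 hq0 hq1 hstq hinv x) (hκ x)
  have hK : 0.5 ≤ K := by
    obtain ⟨x⟩ := ‹Nonempty X›
    have h1 := congrFun (fundamental_mulVec_one hinv hQ1 hq1) x
    simp only [mulVec, dotProduct, mul_one] at h1
    have h2 := (h1.ge.trans (sum_le_sum fun y _ => le_abs_self _)).trans (hκ x)
    norm_num at h2 ⊢
    linarith
  have hpoisson := mulVec_fundamental_mulVec hinv hq1 hstq r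
  have hQg : ∀ x, (Q *ᵥ g) x = g x - r x / 2 - (Q *ᵥ r) x / 2 + c := fun x => by
    have e : g = Z *ᵥ r - (1 / 2 : ℝ) • r := by
      ext y; simp only [hg, Pi.sub_apply, Pi.smul_apply, smul_eq_mul]; ring
    rw [e, mulVec_sub, mulVec_smul]
    simp only [Pi.sub_apply, Pi.smul_apply, smul_eq_mul]
    have := hpoisson x
    change _ = _ + c at this
    rw [this]
    ring
  have hL0 := Real.log_two_gt_d9
  have hL1 := Real.log_two_lt_d9
  rcases le_or_gt rs c with hG | hG
  · exact (sub_nonpos.2 hG).trans (by positivity)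
  rcases le_total K 1.13 with hK1 | hK1
  · set m := log 2 / 4 * (K + 1.5) ^ 2 with hm
    have hm0 : 0 < m := by positivity
    set l := (rs - c) / (2 * m) with hl
    have hl0 : 0 < l := div_pos (by linarith) (by positivity)
    have hml : 2 * (m * l) = rs - c := by rw [hl]; field_simp
    obtain ⟨z₀, hz₀⟩ := exists_potential_shift hK hK1 (m := m) (l := l) (c := c)
      (by rw [hm]; gcongr; linarith) (by rw [hm]; gcongr; linarith) hl0 hc1 (by linarith)
    have hz : ∀ x, _ ∧ _ := fun x =>
      hz₀ (g x) (r x - c) (hgK x) (by linarith [(abs_le.1 (hr1 x)).1])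
    have h := half_mul_reward_le (u := fun x => z₀ + g x + (r x - c) / 2) (l := l)
      (v := l * (c + m * l)) hP0 hP1 hp0 hp1 hν0 hν1 hR (fun _ => rfl) hst hDV
      (fun x => (hz x).2) fun x => by
        refine le_trans (le_of_eq ?_) (hz x).1
        rw [← hmul hQ]
        have e : (Q *ᵥ fun x => z₀ + g x + (r x - c) / 2) x =
            z₀ + (Q *ᵥ g) x + ((Q *ᵥ r) x - c) / 2 := by
          have e1 : ∀ y, Q x y * (z₀ + g y + (r y - c) / 2) =
            Q x y * (z₀ - c / 2) + Q x y * g y + Q x y * r y / 2 := fun y => by ring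
          simp only [mulVec, dotProduct, e1, sum_add_distrib, ← sum_mul, ← sum_div, hQ1]
          ring
        rw [e, hQg]
        ring
    have h' : (rs - c) * l ≤ 4 * ε := by nlinarith
    have hfin : (rs - c) ^ 2 ≤ 2 * ε * log 2 * (1 + (K + 1 / 2)) ^ 2 := by
      rw [hl, mul_div_assoc', div_le_iff₀ (by positivity), hm] at h'
      nlinarith
    have hK2 : 0 < 1 + (K + 1 / 2) := by linarith
    rw [← div_le_iff₀ hK2]
    refine le_sqrt_of_sq_le ?_
    rw [div_pow, div_le_iff₀ (by positivity)]
    exact hfin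
  · have hstep : ∀ f : X → ℝ,
        p ⬝ᵥ f ≤ ε + p ⬝ᵥ fun x => log ((Q *ᵥ fun y => exp (f y)) x) := fun f => by
      have h1 := hDV fun x a => ∑ y, P x a y * f y
      rw [hst] at h1
      refine h1.trans (add_le_add_right (sum_le_sum fun x _ => ?_) ε)
      refine mul_le_mul_of_nonneg_left (log_le_log (sum_mul_exp_pos (hν0 x) (hν1 x) _) ?_) (hp0 x)
      rw [hmul hQ]
      refine sum_le_sum fun a _ => mul_le_mul_of_nonneg_left ?_ (hν0 x a)
      simpa using convexOn_exp.map_sum_le (t := univ) (w := P x a) (p := f)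
        (fun y _ => hP0 x a y) (hP1 x a) fun _ _ => Set.mem_univ _
    have hrew : ∀ l : ℝ, l * rs ≤ ε + p ⬝ᵥ fun x => log (∑ a, ν x a * exp (l * R x a)) :=
      fun l => by
        refine le_trans (le_of_eq ?_) (hDV fun x a => l * R x a)
        simp only [hrs, mul_sum]
        exact sum_congr rfl fun x _ => sum_congr rfl fun a _ => by ring
    have h := two_mul_regret_le hp0 hp1 hQ0 hQ1 hν0 hν1 hR (fun _ => rfl) hrew hstep
      (by linarith) hgK (c := c) fun x => by rw [hQg]; ring
    have h2 : √2 ≤ 1.414214 := sqrt_le_iff.2 ⟨by norm_num, by norm_num⟩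
    have h3 : √3 ≤ 1.732051 := sqrt_le_iff.2 ⟨by norm_num, by norm_num⟩
    have hlog : 0.832554 ≤ √(log 2) := le_sqrt_of_sq_le (by norm_num; linarith)
    have hcoef : 1 / 2 + √2 + √3 / 2 + √2 * K ≤ 2 * (√(log 2) * (1 + (K + 1 / 2))) := by
      nlinarith [mul_le_mul_of_nonneg_right h2 (show 0 ≤ K by linarith),
        mul_le_mul_of_nonneg_right hlog (show 0 ≤ 1 + (K + 1 / 2) by linarith)]
    rw [sqrt_mul' _ (log_nonneg one_le_two)]
    linarith [h.trans (mul_le_mul_of_nonneg_left hcoef (sqrt_nonneg (2 * ε)))]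

end DualBound

/-- Main regret bound: if the averaged KL divergence between the target policy
`μs` and the estimated policy `μh` is at most `ε`, then the difference of
average rewards is bounded by `√(2 ε log 2) · R_max · (1 + κ)`, where `κ` is
the ℓ₁-induced norm of the fundamental matrix of the estimated chain. -/
theorem regret_bound
    {X A : Type*} [Fintype X] [Fintype A] [DecidableEq X] [Nonempty X]
    (P : X → A → X → ℝ)
    (hP0 : ∀ x a y, 0 ≤ P x a y) (hP1 : ∀ x a, ∑ y, P x a y = 1)
    (μs μh : X → A → ℝ)
    (hμs0 : ∀ x a, 0 ≤ μs x a) (hμs1 : ∀ x, ∑ a, μs x a = 1)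
    (hμh0 : ∀ x a, 0 ≤ μh x a) (hμh1 : ∀ x, ∑ a, μh x a = 1)
    (habs : ∀ x a, 0 < μs x a → 0 < μh x a)
    (Ps Ph : Matrix X X ℝ)
    (hPs : ∀ x y, Ps x y = ∑ a, μs x a * P x a y)
    (hPh : ∀ x y, Ph x y = ∑ a, μh x a * P x a y)
    (πs πh : X → ℝ)
    (hπs0 : ∀ x, 0 ≤ πs x) (hπs1 : ∑ x, πs x = 1)
    (hπh0 : ∀ x, 0 ≤ πh x) (hπh1 : ∑ x, πh x = 1)
    (hstats : Matrix.vecMul πs Ps = πs)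
    (hstath : Matrix.vecMul πh Ph = πh)
    (huniqs : ∀ ν : X → ℝ, (∀ x, 0 ≤ ν x) → (∑ x, ν x = 1) →
      Matrix.vecMul ν Ps = ν → ν = πs)
    (huniqh : ∀ ν : X → ℝ, (∀ x, 0 ≤ ν x) → (∑ x, ν x = 1) →
      Matrix.vecMul ν Ph = ν → ν = πh)
    (Zh : Matrix X X ℝ)
    (hZh : Zh = (1 - Ph + Matrix.vecMulVec (fun _ => (1 : ℝ)) πh)⁻¹)
    (hinv : IsUnit (1 - Ph + Matrix.vecMulVec (fun _ => (1 : ℝ)) πh).det)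
    (κ : ℝ) (hκ : κ = ⨆ x : X, ∑ y, |Zh x y|)
    (R : X → A → ℝ) (Rmax : ℝ) (hR : ∀ x a, |R x a| ≤ Rmax)
    (ε : ℝ) (hε : 0 ≤ ε)
    (hKL : (∑ x, πs x * ∑ a, μs x a * Real.log (μs x a / μh x a)) ≤ ε) :
    |(∑ x, πs x * ∑ a, μs x a * R x a) - (∑ x, πh x * ∑ a, μh x a * R x a)| ≤
      Real.sqrt (2 * ε * Real.log 2) * Rmax * (1 + κ) := by
  have hκ' : ∀ x, ∑ y, |(fundamentalInv Ph πh)⁻¹ x y| ≤ κ := fun x => by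
    rw [hκ, hZh]
    exact le_ciSup (f := fun x => ∑ y, |(fundamentalInv Ph πh)⁻¹ x y|)
      (Set.finite_range _).bddAbove x
  have key : ∀ T : X → A → ℝ, (∀ x a, |T x a| ≤ 1) →
      (∑ x, πs x * ∑ a, μs x a * T x a) - (∑ x, πh x * ∑ a, μh x a * T x a) ≤
        √(2 * ε * Real.log 2) * (1 + κ) := fun T hT =>
    average_reward_sub_le hP0 hP1 hμs0 hμs1 hμh0 hμh1 habs hPs hPh hπs0 hπs1 hπh0 hπh1
      hstats hstath hinv hκ' hT hKL
  have hRmax : 0 ≤ Rmax := by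
    obtain ⟨x⟩ := ‹Nonempty X›
    obtain ⟨a, -, -⟩ := exists_ne_zero_of_sum_ne_zero ((hμs1 x).trans_ne one_ne_zero)
    exact (abs_nonneg _).trans (hR x a)
  rcases hRmax.eq_or_lt with h0 | hpos
  · have hR0 : ∀ x a, R x a = 0 := fun x a => abs_nonpos_iff.1 ((hR x a).trans_eq h0.symm)
    simp [hR0, ← h0]
  have hscale : ∀ (s : ℝ) (w : X → ℝ) (μ : X → A → ℝ),
      ∑ x, w x * ∑ a, μ x a * (s * R x a) = s * ∑ x, w x * ∑ a, μ x a * R x a := fun s w μ => by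
    simp only [mul_sum]
    exact sum_congr rfl fun x _ => sum_congr rfl fun a _ => by ring
  have hone : ∀ s : ℝ, |s| = 1 → s * ((∑ x, πs x * ∑ a, μs x a * R x a) -
      (∑ x, πh x * ∑ a, μh x a * R x a)) ≤ √(2 * ε * Real.log 2) * Rmax * (1 + κ) :=
    fun s hs => by
      have h := key (fun x a => s / Rmax * R x a) fun x a => by
        rw [abs_mul, abs_div, hs, abs_of_pos hpos, one_div_mul_eq_div, div_le_one hpos]
        exact hR x a
      rw [hscale, hscale, ← mul_sub, div_mul_eq_mul_div, div_le_iff₀ hpos] at h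
      linarith
  exact abs_le.2 ⟨by linarith [hone (-1) (by simp)], by linarith [hone 1 (by simp)]⟩
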